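/- arXiv:math/0606270 — 7 statements merged into one kernel-verified Lean document; each statement's English description precedes it below -/
import Mathlib

section
/- Let X be a Lindelöf zero-dimensional topological space and let S₀ = {1/n : n ∈ ℕ} ∪ {0}. Then there is a function D : C_p(X) → C_p(X,S₀) such that for every continuous f : X → ℝ and every x ∈ X: (1) f(x) = 0 if and only if D(f)(x) = 0; and (2) for every natural number k ≥ 2, if |f(x)| ≤ 1/k then D(f)(x) ≤ 1/k, and if D(f)(x) < 1/k then |f(x)| < 1/k. -/
open Set Topology Filter

/-- The Pytkeev property of a topological space. -/
def PytkeevProp (Y : Type*) [TopologicalSpace Y] : Prop :=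
  ∀ A : Set Y, ∀ y : Y, y ∈ closure A \ A →
    ∃ 𝒜 : ℕ → Set Y, (∀ n, (𝒜 n).Infinite ∧ 𝒜 n ⊆ A) ∧
      ∀ U ∈ nhds y, ∃ n, 𝒜 n ⊆ U

/-- Countable tightness. -/
def CountableTightness (Y : Type*) [TopologicalSpace Y] : Prop :=
  ∀ A : Set Y, ∀ y ∈ closure A, ∃ B ⊆ A, B.Countable ∧ y ∈ closure B

/-- The Reznichenko property (weakly Fréchet-Urysohn). -/
def ReznichenkoProp (Y : Type*) [TopologicalSpace Y] : Prop :=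
  ∀ A : Set Y, ∀ y : Y, y ∈ closure A \ A →
    ∃ F : ℕ → Set Y, (∀ n, F n ⊆ A ∧ (F n).Finite) ∧
      (∀ m n, m ≠ n → Disjoint (F m) (F n)) ∧
      ∀ U ∈ nhds y, ∀ᶠ n in Filter.atTop, (F n ∩ U).Nonempty

/-- `C_p(X)`: continuous real-valued functions on `X`, as a subspace of `ℝ^X`
with the product (pointwise convergence) topology. -/
abbrev Cp (X : Type*) [TopologicalSpace X] : Type _ :=
  {f : X → ℝ // Continuous f}

/-- `C_p(X, S)`: continuous functions from `X` to `S ⊆ ℝ`, as a subspace of `ℝ^X`. -/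
abbrev CpS (X : Type*) [TopologicalSpace X] (S : Set ℝ) : Type _ :=
  {f : X → ℝ // Continuous f ∧ ∀ x, f x ∈ S}

/-- `A` is a pseudo-intersection of `ℱ`: `A` is infinite and almost contained
in every member of `ℱ`. -/
def IsPseudoIntersection (A : Set ℕ) (ℱ : Set (Set ℕ)) : Prop :=
  A.Infinite ∧ ∀ B ∈ ℱ, (A \ B).Finite

/-- A centered family in `[ℕ]^ω`: every nonempty finite subfamily has infinite
intersection (in particular all members are infinite). -/
def IsCentered (ℱ : Set (Set ℕ)) : Prop :=
  ∀ 𝒢 ⊆ ℱ, 𝒢.Finite → 𝒢.Nonempty → (⋂₀ 𝒢).Infinite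

/-- The pseudo-intersection number 𝔭. -/
noncomputable def pNumber : Cardinal :=
  sInf { c : Cardinal | ∃ ℱ : Set (Set ℕ), IsCentered ℱ ∧
    (¬ ∃ A, IsPseudoIntersection A ℱ) ∧ Cardinal.mk ℱ = c }

/-- The cardinal 𝔭_σ. -/
noncomputable def pSigmaNumber : Cardinal :=
  sInf { c : Cardinal | ∃ ℱ : Set (Set ℕ), IsCentered ℱ ∧
    (∀ 𝒬 : ℕ → Set (Set ℕ), (⋃ n, 𝒬 n) = ℱ →
      ∃ n, ¬ ∃ A, IsPseudoIntersection A (𝒬 n)) ∧ Cardinal.mk ℱ = c }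

/-- A tower: a family in `[ℕ]^ω` linearly ordered by `⊆*` with no
pseudo-intersection. -/
def IsTower (ℱ : Set (Set ℕ)) : Prop :=
  (∀ A ∈ ℱ, A.Infinite) ∧
  (∀ A ∈ ℱ, ∀ B ∈ ℱ, (A \ B).Finite ∨ (B \ A).Finite) ∧
  ¬ ∃ A, IsPseudoIntersection A ℱ

/-- The tower number 𝔱. -/
noncomputable def tNumber : Cardinal :=
  sInf { c : Cardinal | ∃ ℱ : Set (Set ℕ), IsTower ℱ ∧ Cardinal.mk ℱ = c }

/-- An ω-cover of `X`: `X` itself is not a member, and every finite subset of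
`X` is contained in some member. -/
def IsOmegaCover {X : Type*} (𝒰 : Set (Set X)) : Prop :=
  Set.univ ∉ 𝒰 ∧ ∀ F : Set X, F.Finite → ∃ U ∈ 𝒰, F ⊆ U

/-- `⟨ℱ⟩`: the closure of `ℱ` under intersections of (nonempty) finite subfamilies. -/
def FinInterClosure (ℱ : Set (Set ℕ)) : Set (Set ℕ) :=
  { S | ∃ 𝒢 ⊆ ℱ, 𝒢.Finite ∧ 𝒢.Nonempty ∧ S = ⋂₀ 𝒢 }

/-- A zero-dimensional space: the clopen sets form a base. -/
def ZeroDimensionalSpace (X : Type*) [TopologicalSpace X] : Prop :=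
  ∀ x : X, ∀ U ∈ nhds x, ∃ V : Set X, IsClopen V ∧ x ∈ V ∧ V ⊆ U

/-- The set `S₀ = {1/n : n ∈ ℕ} ∪ {0} ⊆ ℝ`. -/
def Szero : Set ℝ := {x : ℝ | ∃ n : ℕ, x = 1 / (n + 1)} ∪ {0}

/-- An ω-groupable family: it can be partitioned into finite pieces such that
every finite `F ⊆ X` is contained in some member of all but finitely many pieces. -/
def IsOmegaGroupable {X : Type*} (𝒰 : Set (Set X)) : Prop :=
  ∃ 𝒬 : Set (Set (Set X)), (∀ ℱ ∈ 𝒬, ℱ.Finite) ∧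
    𝒬.PairwiseDisjoint id ∧ ⋃₀ 𝒬 = 𝒰 ∧
    ∀ F : Set X, F.Finite → { ℱ ∈ 𝒬 | ¬ ∃ U ∈ ℱ, F ⊆ U }.Finite

theorem clopen_sep_aux {X : Type*} [TopologicalSpace X] [LindelofSpace X]
    (hz : ZeroDimensionalSpace X) (A B : Set X) (hA : IsClosed A) (hB : IsClosed B)
    (hAB : Disjoint A B) : ∃ U : Set X, IsClopen U ∧ A ⊆ U ∧ Disjoint U B := by
  have h1 : ∀ x : X, ∃ V : Set X, IsClopen V ∧ x ∈ V ∧ (Disjoint V A ∨ Disjoint V B) := by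
    intro x
    by_cases hx : x ∈ A
    · obtain ⟨V, h, h', h''⟩ := hz x Bᶜ (hB.isOpen_compl.mem_nhds
        (Set.disjoint_left.1 hAB hx))
      exact ⟨V, h, h', Or.inr (Set.disjoint_left.2 fun y hy => h'' hy)⟩
    · obtain ⟨V, h, h', h''⟩ := hz x Aᶜ (hA.isOpen_compl.mem_nhds hx)
      exact ⟨V, h, h', Or.inl (Set.disjoint_left.2 fun y hy => h'' hy)⟩
  choose V hV hxV hd using h1
  rcases isEmpty_or_nonempty X with hX | hX
  · exact ⟨∅, isClopen_empty, fun x => (hX.false x).elim, by simp⟩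
  obtain ⟨t, htc, ht⟩ := LindelofSpace.elim_nhds_subcover V
    (fun x => (hV x).isOpen.mem_nhds (hxV x))
  have htne : t.Nonempty := by
    obtain ⟨x⟩ := hX
    have : x ∈ ⋃ x ∈ t, V x := by rw [ht]; trivial
    simp only [mem_iUnion] at this
    obtain ⟨y, hy, _⟩ := this
    exact ⟨y, hy⟩
  obtain ⟨e, he⟩ := htc.exists_eq_range htne
  have hcov : ∀ x, ∃ n, x ∈ V (e n) := by
    intro x
    have : x ∈ ⋃ x ∈ t, V x := by rw [ht]; trivial
    rw [he] at this
    simpa using this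
  let W : ℕ → Set X := fun n => V (e n) \ ⋃ m ∈ Set.Iio n, V (e m)
  have hW : ∀ n, IsClopen (W n) := fun n =>
    (hV _).diff ((Set.finite_Iio n).isClopen_biUnion fun m _ => hV _)
  have hWcov : ∀ x, ∃ n, x ∈ W n := by
    classical
    intro x
    refine ⟨Nat.find (hcov x), Nat.find_spec (hcov x), ?_⟩
    simp only [mem_iUnion, not_exists]
    intro m hm
    exact Nat.find_min (hcov x) hm
  have hWdisj : ∀ x m n, x ∈ W m → x ∈ W n → m = n := by
    intro x m n hm hn
    rcases lt_trichotomy m n with h | h | h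
    · exact (hn.2 (mem_biUnion (show m ∈ Set.Iio n from h) hm.1)).elim
    · exact h
    · exact (hm.2 (mem_biUnion (show n ∈ Set.Iio m from h) hn.1)).elim
  have hop : ∀ P : ℕ → Prop, IsOpen (⋃ n, ⋃ _ : P n, W n) := fun P =>
    isOpen_iUnion fun n => isOpen_iUnion fun _ => (hW n).isOpen
  refine ⟨⋃ n, ⋃ _ : (W n ∩ A).Nonempty, W n, ⟨?_, hop _⟩, ?_, ?_⟩
  · rw [← isOpen_compl_iff]
    convert hop (fun n => ¬ (W n ∩ A).Nonempty) using 1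
    ext x
    simp only [mem_compl_iff, mem_iUnion, not_exists]
    constructor
    · intro h
      obtain ⟨n, hn⟩ := hWcov x
      exact ⟨n, fun hh => h n hh hn, hn⟩
    · rintro ⟨n, h, hn⟩ m hm hxm
      rw [hWdisj x m n hxm hn] at hm
      exact h hm
  · intro x hx
    obtain ⟨n, hn⟩ := hWcov x
    simp only [mem_iUnion]
    exact ⟨n, ⟨x, hn, hx⟩, hn⟩
  · rw [Set.disjoint_left]
    intro x hx hxB
    simp only [mem_iUnion] at hx
    obtain ⟨n, ⟨a, ha, haA⟩, hn⟩ := hx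
    rcases hd (e n) with h | h
    · exact Set.disjoint_left.1 h ha.1 haA
    · exact Set.disjoint_left.1 h hn.1 hxB

theorem Szero_gap_aux {y : ℝ} (hy : y ∈ Szero) (n : ℕ) (h : y < 1 / ((n : ℝ) + 1)) :
    y ≤ 1 / (((n + 1 : ℕ) : ℝ) + 1) := by
  rcases hy with ⟨m, rfl⟩ | hy
  · have h2 := lt_of_one_div_lt_one_div (by positivity) h
    have : n + 1 < m + 1 := by exact_mod_cast h2
    apply one_div_le_one_div_of_le (by positivity)
    have h3 : n + 1 ≤ m := by omega
    have : ((n + 1 : ℕ) : ℝ) ≤ m := by exact_mod_cast h3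
    linarith
  · rw [mem_singleton_iff.1 hy]; positivity

theorem Szero_nonneg_aux {y : ℝ} (hy : y ∈ Szero) : 0 ≤ y := by
  rcases hy with ⟨m, rfl⟩ | hy
  · positivity
  · rw [mem_singleton_iff.1 hy]

theorem exists_fun_aux {X : Type*} [TopologicalSpace X] (V : ℕ → Set X)
    (h0 : V 0 = univ) (hV : ∀ n, IsClopen (V n)) (hanti : Antitone V) :
    ∃ D : X → ℝ, Continuous D ∧ (∀ x, D x ∈ Szero) ∧
      ∀ x (n : ℕ), D x ≤ 1 / ((n : ℝ) + 1) ↔ x ∈ V n := by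
  have hex : ∀ x, ∃ y ∈ Szero, ∀ n : ℕ, y ≤ 1 / ((n : ℝ) + 1) ↔ x ∈ V n := by
    classical
    intro x
    by_cases h : ∃ n, x ∉ V n
    · have hs := Nat.find_spec h
      have hm := fun m => Nat.find_min h (m := m)
      generalize Nat.find h = p at hs hm
      rcases p with _ | p
      · simp [h0] at hs
      · refine ⟨1 / ((p : ℝ) + 1), Or.inl ⟨p, rfl⟩, fun n => ?_⟩
        rw [one_div_le_one_div (by positivity) (by positivity)]
        constructor
        · intro hn
          have : n ≤ p := by
            have : (n : ℝ) ≤ p := by linarith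
            exact_mod_cast this
          exact not_not.1 (hm n (by omega))
        · intro hn
          have : n ≤ p := by
            by_contra hlt
            exact hs (hanti (by omega) hn)
          have : (n : ℝ) ≤ p := by exact_mod_cast this
          linarith
    · push Not at h
      exact ⟨0, Or.inr rfl, fun n => ⟨fun _ => h n, fun _ => by positivity⟩⟩
  choose D hS hD using hex
  refine ⟨D, ?_, hS, hD⟩
  rw [continuous_iff_continuousAt]
  intro x
  refine tendsto_order.2 ⟨fun a ha => ?_, fun a ha => ?_⟩
  · rcases hS x with ⟨m, hm⟩ | hx
    · have hx : x ∉ V (m + 1) := by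
        rw [← hD, hm, not_le]
        apply one_div_lt_one_div_of_lt (by positivity)
        push_cast; linarith
      filter_upwards [(hV (m + 1)).compl.isOpen.mem_nhds hx] with y hy
      by_contra hlt
      exact hy ((hD _ _).1 (Szero_gap_aux (hS y) m (by linarith)))
    · rw [mem_singleton_iff.1 hx] at ha
      exact Eventually.of_forall fun y => ha.trans_le (Szero_nonneg_aux (hS y))
  · obtain ⟨n, hn1, hn2⟩ : ∃ n : ℕ, D x ≤ 1 / ((n : ℝ) + 1) ∧ 1 / ((n : ℝ) + 1) < a := by
      rcases hS x with ⟨m, hm⟩ | hx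
      · exact ⟨m, hm.le, hm ▸ ha⟩
      · rw [mem_singleton_iff.1 hx] at ha ⊢
        obtain ⟨n, hn⟩ := exists_nat_one_div_lt ha
        exact ⟨n, by positivity, hn⟩
    filter_upwards [(hV n).isOpen.mem_nhds ((hD _ _).1 hn1)] with y hy
    exact ((hD _ _).2 hy).trans_lt hn2

theorem exists_disc_aux {X : Type*} [TopologicalSpace X] [LindelofSpace X]
    (hz : ZeroDimensionalSpace X) (f : Cp X) : ∃ D : CpS X Szero, ∀ x : X,
      (f.1 x = 0 ↔ D.1 x = 0) ∧
      ∀ k : ℕ, 2 ≤ k →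
        ((|f.1 x| ≤ 1 / (k : ℝ) → D.1 x ≤ 1 / (k : ℝ)) ∧
         (D.1 x < 1 / (k : ℝ) → |f.1 x| < 1 / (k : ℝ))) := by
  have hc : Continuous fun x => |f.1 x| := f.2.abs
  have hU : ∀ n : ℕ, ∃ U : Set X, IsClopen U ∧ {x | |f.1 x| ≤ 1 / ((n : ℝ) + 2)} ⊆ U ∧
      Disjoint U {x | 1 / ((n : ℝ) + 1) ≤ |f.1 x|} := by
    intro n
    refine clopen_sep_aux hz _ _ (isClosed_le hc continuous_const)
      (isClosed_le continuous_const hc) ?_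
    rw [Set.disjoint_left]
    intro x hx hx'
    have h1 : 1 / ((n : ℝ) + 2) < 1 / ((n : ℝ) + 1) :=
      one_div_lt_one_div_of_lt (by positivity) (by linarith)
    simp only [mem_ofPred_eq] at hx hx'
    linarith
  choose U hUc hUA hUB using hU
  have hUB' : ∀ n x, x ∈ U n → |f.1 x| < 1 / ((n : ℝ) + 1) := fun n x hx =>
    not_le.1 fun h => Set.disjoint_left.1 (hUB n) hx h
  let V : ℕ → Set X := fun n => Nat.casesOn n univ U
  obtain ⟨D, hDc, hDS, hD⟩ := exists_fun_aux V rfl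
    (fun n => by cases n; exacts [isClopen_univ, hUc _])
    (antitone_nat_of_succ_le fun n => by
      cases n with
      | zero => exact subset_univ _
      | succ n =>
        intro x hx
        apply hUA n
        have := hUB' _ x hx
        push_cast at this
        rw [mem_ofPred_eq]
        rw [show (n : ℝ) + 2 = n + 1 + 1 by ring]
        exact this.le)
  refine ⟨⟨D, hDc, hDS⟩, fun x => ⟨⟨fun h => ?_, fun h => ?_⟩, fun k hk => ⟨fun h => ?_, fun h => ?_⟩⟩⟩
  · refine le_antisymm (le_of_forall_pos_le_add fun ε hε => ?_) (Szero_nonneg_aux (hDS x))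
    obtain ⟨n, hn⟩ := exists_nat_one_div_lt hε
    have : x ∈ V n := by
      cases n with
      | zero => trivial
      | succ n =>
        apply hUA n
        rw [mem_ofPred_eq, h, abs_zero]; positivity
    have := (hD x n).2 this
    simp only
    linarith
  · refine abs_eq_zero.1 (le_antisymm (le_of_forall_pos_le_add fun ε hε => ?_) (abs_nonneg _))
    obtain ⟨n, hn⟩ := exists_nat_one_div_lt hε
    have h' : D x = 0 := h
    have := hUB' n x ((hD x (n + 1)).1 (by rw [h']; positivity))
    linarith
  · obtain ⟨n, rfl⟩ := Nat.exists_eq_add_of_le' hk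
    have := (hD x (n + 1)).2 (hUA n (by simpa using h))
    push_cast at this ⊢
    rw [show (n : ℝ) + 2 = n + 1 + 1 by ring]
    exact this
  · obtain ⟨n, rfl⟩ := Nat.exists_eq_add_of_le' (show 1 ≤ k by omega)
    have h' : D x < 1 / ((n : ℝ) + 1) := by simpa using h
    have := hUB' n x ((hD x (n + 1)).1 (Szero_gap_aux (hDS x) n h'))
    simpa using this

/-- Discretization: for Lindelöf zero-dimensional `X` there is
`D : C_p(X) → C_p(X,S₀)` as in the lemma. -/
theorem statement13 (X : Type*) [TopologicalSpace X] [LindelofSpace X]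
    (hz : ZeroDimensionalSpace X) :
    ∃ D : Cp X → CpS X Szero, ∀ f : Cp X, ∀ x : X,
      (f.1 x = 0 ↔ (D f).1 x = 0) ∧
      ∀ k : ℕ, 2 ≤ k →
        ((|f.1 x| ≤ 1 / (k : ℝ) → (D f).1 x ≤ 1 / (k : ℝ)) ∧
         ((D f).1 x < 1 / (k : ℝ) → |f.1 x| < 1 / (k : ℝ))) := by
  choose D hD using fun f : Cp X => exists_disc_aux hz f
  exact ⟨D, hD⟩
end

section
/- Let X be a Tychonoff space and S₀ = {1/n : n ∈ ℕ} ∪ {0}. The following are equivalent: (1) C_p(X) has the Pytkeev property; (2) X is zero-dimensional and C_p(X,S₀) has the Pytkeev property; (3) X is zero-dimensional and C_p(X,{0,1}) has the Pytkeev property. -/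
open Set Topology Filter

theorem pk_nhds_elim {X : Type*} {P : (X → ℝ) → Prop} (y : {f : X → ℝ // P f})
    {U : Set {f : X → ℝ // P f}} (hU : U ∈ 𝓝 y) :
    ∃ F : Finset X, ∃ ε > 0, ∀ g : {f : X → ℝ // P f},
      (∀ x ∈ F, |g.1 x - y.1 x| < ε) → g ∈ U := by
  rw [nhds_subtype_eq_comap, Filter.mem_comap] at hU
  obtain ⟨W, hW, hWU⟩ := hU
  obtain ⟨O, hOW, hO, hyO⟩ := mem_nhds_iff.1 hW
  obtain ⟨F, u, hu, hsub⟩ := isOpen_pi_iff.1 hO y.1 hyO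
  have : ∀ x : X, ∃ ε > 0, x ∈ F → Metric.ball (y.1 x) ε ⊆ u x := by
    intro x
    by_cases hx : x ∈ F
    · obtain ⟨ε, h0, h⟩ := Metric.isOpen_iff.1 (hu x hx).1 _ (hu x hx).2
      exact ⟨ε, h0, fun _ => h⟩
    · exact ⟨1, one_pos, fun h => absurd h hx⟩
  choose e he heu using this
  have : ∃ ε > 0, ∀ x ∈ F, ε ≤ e x := by
    by_cases hF : F.Nonempty
    · obtain ⟨a, ha, hm⟩ := F.exists_min_image e hF
      exact ⟨e a, he a, hm⟩
    · rw [Finset.not_nonempty_iff_eq_empty] at hF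
      exact ⟨1, one_pos, by simp [hF]⟩
  obtain ⟨ε, h0, hε⟩ := this
  refine ⟨F, ε, h0, fun g hg => hWU (hOW (hsub ?_))⟩
  intro x hx
  apply heu x hx
  rw [Metric.mem_ball, Real.dist_eq]
  exact (hg x hx).trans_le (hε x hx)

theorem pk_nhds_intro {X : Type*} {P : (X → ℝ) → Prop} (y : {f : X → ℝ // P f})
    (F : Finset X) {ε : ℝ} (h0 : 0 < ε) :
    {g : {f : X → ℝ // P f} | ∀ x ∈ F, |g.1 x - y.1 x| < ε} ∈ 𝓝 y := by
  have : {g : {f : X → ℝ // P f} | ∀ x ∈ F, |g.1 x - y.1 x| < ε}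
      = ⋂ x ∈ F, {g : {f : X → ℝ // P f} | |g.1 x - y.1 x| < ε} := by
    ext g; simp
  rw [this]
  apply (Filter.biInter_finset_mem F).2
  intro x _
  apply IsOpen.mem_nhds
  · exact isOpen_lt ((((continuous_apply x).comp continuous_subtype_val).sub continuous_const).abs) continuous_const
  · simpa using h0

theorem pk_mem_closure {X : Type*} {P : (X → ℝ) → Prop} (y : {f : X → ℝ // P f})
    {A : Set {f : X → ℝ // P f}} (h : ∀ (F : Finset X) (ε : ℝ), 0 < ε →
      ∃ g ∈ A, ∀ x ∈ F, |g.1 x - y.1 x| < ε) : y ∈ closure A := by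
  rw [mem_closure_iff_nhds]
  intro U hU
  obtain ⟨F, ε, h0, hF⟩ := pk_nhds_elim y hU
  obtain ⟨g, hg, hgF⟩ := h F ε h0
  exact ⟨g, hF g hgF, hg⟩

theorem pk_of_closure {X : Type*} {P : (X → ℝ) → Prop} (y : {f : X → ℝ // P f})
    {A : Set {f : X → ℝ // P f}} (h : y ∈ closure A) (F : Finset X) {ε : ℝ} (h0 : 0 < ε) :
      ∃ g ∈ A, ∀ x ∈ F, |g.1 x - y.1 x| < ε := by
  obtain ⟨g, h1, h2⟩ := mem_closure_iff_nhds.1 h _ (pk_nhds_intro y F h0)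
  exact ⟨g, h2, h1⟩

/-- The Pytkeev property passes to subspaces. -/
theorem pk_mono {X : Type*} {P Q : (X → ℝ) → Prop} (hPQ : ∀ f, P f → Q f)
    (hQ : PytkeevProp {f : X → ℝ // Q f}) : PytkeevProp {f : X → ℝ // P f} := by
  intro A y hy
  let i : {f : X → ℝ // P f} → {f : X → ℝ // Q f} := fun f => ⟨f.1, hPQ _ f.2⟩
  have hi : Function.Injective i := by
    intro a b h
    exact Subtype.ext (congrArg (fun z => z.1) h)
  obtain ⟨B, hB, hBU⟩ := hQ (i '' A) (i y) ⟨by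
    apply pk_mem_closure
    intro F ε h0
    obtain ⟨g, hg, h⟩ := pk_of_closure y hy.1 F h0
    exact ⟨i g, ⟨g, hg, rfl⟩, h⟩, by
    rintro ⟨z, hz, h⟩
    exact hy.2 (hi h ▸ hz)⟩
  refine ⟨fun n => i ⁻¹' (B n), fun n => ⟨?_, ?_⟩, ?_⟩
  · apply (hB n).1.preimage
    intro b hb
    obtain ⟨a, _, h⟩ := (hB n).2 hb
    exact ⟨a, h⟩
  · intro a ha
    obtain ⟨b, hb, h⟩ := (hB n).2 ha
    exact hi h ▸ hb
  · intro U hU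
    obtain ⟨F, ε, h0, hF⟩ := pk_nhds_elim y hU
    obtain ⟨n, hn⟩ := hBU _ (pk_nhds_intro (i y) F h0)
    exact ⟨n, fun a ha => hF a (hn ha)⟩

/-- The indicator of the complement of a clopen set. -/
noncomputable def pkInd {X : Type*} [TopologicalSpace X] (V : Set X) (hV : IsClopen V) :
    CpS X ({0, 1} : Set ℝ) :=
  ⟨Vᶜ.indicator (fun _ => 1), by
    refine ⟨continuous_const.indicator ?_, ?_⟩
    · intro x hx
      rw [hV.compl.frontier_eq] at hx
      exact hx.elim
    · intro x
      by_cases h : x ∈ V <;> simp [h]⟩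

theorem pkInd_zero {X : Type*} [TopologicalSpace X] {V : Set X} (hV : IsClopen V) {x : X}
    (h : x ∈ V) : (pkInd V hV).1 x = 0 := by simp [pkInd, h]

theorem pkInd_lt {X : Type*} [TopologicalSpace X] {V : Set X} (hV : IsClopen V) {x : X}
    (h : (pkInd V hV).1 x < 1) : x ∈ V := by
  by_contra hx
  simp [pkInd, hx] at h

noncomputable def pkZero (X : Type*) [TopologicalSpace X] : CpS X ({0, 1} : Set ℝ) :=
  ⟨fun _ => 0, continuous_const, by simp⟩

theorem pk_clopen_finset {X : Type*} [TopologicalSpace X] [T2Space X]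
    (hz : ZeroDimensionalSpace X) (F : Finset X) (O : Set X) (hO : IsOpen O) (hF : ↑F ⊆ O) :
    ∃ V, IsClopen V ∧ ↑F ⊆ V ∧ V ⊆ O := by
  classical
  induction F using Finset.induction_on with
  | empty => exact ⟨∅, isClopen_empty, by simp, by simp⟩
  | insert a s _ ih =>
    rw [Finset.coe_insert, Set.insert_subset_iff] at hF
    obtain ⟨V, hV, h1, h2⟩ := ih hF.2
    obtain ⟨W, hW, h3, h4⟩ := hz a O (hO.mem_nhds hF.1)
    refine ⟨W ∪ V, hW.union hV, ?_, Set.union_subset h4 h2⟩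
    rw [Finset.coe_insert, Set.insert_subset_iff]
    exact ⟨Or.inl h3, h1.trans Set.subset_union_right⟩

theorem pk_separate {X : Type*} [TopologicalSpace X] [T2Space X]
    (hz : ZeroDimensionalSpace X) (hP : PytkeevProp (CpS X ({0, 1} : Set ℝ)))
    (Z W : Set X) (hZ : IsClosed Z) (hW : IsClosed W) (hd : Disjoint Z W) :
    ∃ C, IsClopen C ∧ Z ⊆ C ∧ Disjoint C W := by
  classical
  -- a countable clopen cover by nice sets
  have key : ∃ P Q : ℕ → Set X, (∀ n, IsClopen (P n) ∧ IsClopen (Q n) ∧ Disjoint (P n) Z ∧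
      Disjoint (Q n) W) ∧ ∀ x, ∃ n, x ∈ P n ∪ Q n := by
    let N : Set (Set X) := {V | ∃ P Q, IsClopen P ∧ IsClopen Q ∧ Disjoint P Z ∧
      Disjoint Q W ∧ V = P ∪ Q}
    suffices h : ∃ V : ℕ → Set X, (∀ n, V n ∈ N) ∧ ∀ x, ∃ n, x ∈ V n by
      obtain ⟨V, hV, hc⟩ := h
      choose P Q h1 h2 h3 h4 h5 using hV
      refine ⟨P, Q, fun n => ⟨h1 n, h2 n, h3 n, h4 n⟩, fun x => ?_⟩
      obtain ⟨n, hn⟩ := hc x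
      exact ⟨n, h5 n ▸ hn⟩
    by_cases hu : Set.univ ∈ N
    · exact ⟨fun _ => Set.univ, fun _ => hu, fun x => ⟨0, trivial⟩⟩
    let A : Set (CpS X ({0, 1} : Set ℝ)) := {f | ∃ V, ∃ hV : IsClopen V, V ∈ N ∧ f = pkInd V hV}
    obtain ⟨B, hB, hBU⟩ := hP A (pkZero X) ⟨by
      apply pk_mem_closure
      intro F ε h0
      obtain ⟨P, hP, hFP, hPs⟩ := pk_clopen_finset hz (F.filter (· ∉ Z)) Zᶜ hZ.isOpen_compl
        (by intro x hx; simpa using (Finset.mem_filter.1 (Finset.mem_coe.1 hx)).2)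
      obtain ⟨Q, hQ, hFQ, hQs⟩ := pk_clopen_finset hz (F.filter (· ∈ Z)) Wᶜ hW.isOpen_compl
        (by intro x hx
            exact Set.disjoint_left.1 hd (Finset.mem_filter.1 (Finset.mem_coe.1 hx)).2)
      refine ⟨pkInd (P ∪ Q) (hP.union hQ), ⟨_, _, ⟨P, Q, hP, hQ,
        Set.disjoint_left.2 hPs, Set.disjoint_left.2 hQs, rfl⟩, rfl⟩, ?_⟩
      intro x hx
      rw [pkInd_zero]
      · simpa [pkZero] using h0
      · by_cases hxZ : x ∈ Z
        · exact Or.inr (hFQ (Finset.mem_coe.2 (Finset.mem_filter.2 ⟨hx, hxZ⟩)))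
        · exact Or.inl (hFP (Finset.mem_coe.2 (Finset.mem_filter.2 ⟨hx, hxZ⟩))), by
      rintro ⟨V, hV, hVN, h⟩
      apply hu
      convert hVN
      symm
      rw [Set.eq_univ_iff_forall]
      intro x
      apply pkInd_lt hV
      rw [← h]
      exact one_pos⟩
    have : ∀ n, ∃ V, ∃ hV : IsClopen V, V ∈ N ∧ pkInd V hV ∈ B n := by
      intro n
      obtain ⟨f, hf⟩ := (hB n).1.nonempty
      obtain ⟨V, hV, hN, rfl⟩ := (hB n).2 hf
      exact ⟨V, hV, hN, hf⟩
    choose V hV hN hVB using this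
    refine ⟨V, hN, fun x => ?_⟩
    obtain ⟨n, hn⟩ := hBU _ (pk_nhds_intro (pkZero X) {x} one_pos)
    refine ⟨n, pkInd_lt (hV n) ?_⟩
    have := hn (hVB n) x (by simp)
    have := (abs_lt.1 this).2
    simpa [pkZero] using this
  obtain ⟨P, Q, hPQ, hc⟩ := key
  let D : ℕ → Set X := fun n => (P n ∪ Q n) \ ⋃ j ∈ Finset.range n, (P j ∪ Q j)
  have hD : ∀ n, IsOpen (D n) := by
    intro n
    refine ((hPQ n).1.union (hPQ n).2.1).isOpen.sdiff ?_
    exact Set.Finite.isClosed_biUnion (Finset.finite_toSet _)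
      (fun j _ => ((hPQ j).1.union (hPQ j).2.1).isClosed)
  have hDc : ∀ x, ∃ n, x ∈ D n := by
    intro x
    refine ⟨Nat.find (hc x), Nat.find_spec (hc x), ?_⟩
    simp only [Finset.mem_range, Set.mem_iUnion, not_exists]
    intro j hj
    exact Nat.find_min (hc x) hj
  have hDd : ∀ x m n, m < n → x ∈ D m → x ∉ D n := by
    intro x m n hmn hm hn
    apply hn.2
    simp only [Finset.mem_range, Set.mem_iUnion]
    exact ⟨m, hmn, hm.1⟩
  have hDu : ∀ x m n, x ∈ D m → x ∈ D n → m = n := by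
    intro x m n hm hn
    rcases lt_trichotomy m n with h | h | h
    · exact absurd hn (hDd x m n h hm)
    · exact h
    · exact absurd hm (hDd x n m h hn)
  have hcompl : (⋃ n, D n ∩ Q n)ᶜ = ⋃ n, D n \ Q n := by
    ext x
    simp only [Set.mem_compl_iff, Set.mem_iUnion, not_exists, Set.mem_inter_iff, Set.mem_sdiff]
    constructor
    · intro h
      obtain ⟨n, hn⟩ := hDc x
      exact ⟨n, hn, fun hq => h n ⟨hn, hq⟩⟩
    · rintro ⟨n, hn, hq⟩ m ⟨hm, hmq⟩
      exact hq (hDu x m n hm hn ▸ hmq)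
  refine ⟨⋃ n, D n ∩ Q n, ⟨?_, isOpen_iUnion fun n => (hD n).inter (hPQ n).2.1.isOpen⟩, ?_, ?_⟩
  · rw [← isOpen_compl_iff, hcompl]
    exact isOpen_iUnion fun n => (hD n).sdiff (hPQ n).2.1.isClosed
  · intro x hx
    by_contra hxc
    have : x ∈ (⋃ n, D n ∩ Q n)ᶜ := hxc
    rw [hcompl, Set.mem_iUnion] at this
    obtain ⟨n, hn, hq⟩ := this
    rcases hn.1 with h | h
    · exact Set.disjoint_left.1 (hPQ n).2.2.1 h hx
    · exact hq h
  · rw [Set.disjoint_left]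
    intro x hx hxW
    obtain ⟨n, hn⟩ := Set.mem_iUnion.1 hx
    exact Set.disjoint_left.1 (hPQ n).2.2.2 hn.2 hxW

theorem pk_main {X : Type*} [TopologicalSpace X] [T2Space X]
    (hz : ZeroDimensionalSpace X) (hP : PytkeevProp (CpS X ({0, 1} : Set ℝ))) :
    PytkeevProp (Cp X) := by
  classical
  intro A y hy
  let H : ℕ → Set (Cp X) := fun n => {h | h ∈ A ∧ ∀ x, |h.1 x - y.1 x| < 1 / ((n : ℝ) + 1)}
  have hHanti : ∀ m n, m ≤ n → H n ⊆ H m := by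
    intro m n hmn h hh
    exact ⟨hh.1, fun x => (hh.2 x).trans_le (Nat.one_div_le_one_div hmn)⟩
  have hHout : ∀ h ∈ A, ∃ n, h ∉ H n := by
    intro h hA
    have hne : h ≠ y := fun e => hy.2 (e ▸ hA)
    have : ∃ x, h.1 x ≠ y.1 x := by
      by_contra hcon
      push Not at hcon
      exact hne (Subtype.ext (funext hcon))
    obtain ⟨x, hx⟩ := this
    obtain ⟨n, hn⟩ := exists_nat_one_div_lt (abs_pos.2 (sub_ne_zero.2 hx))
    exact ⟨n, fun hh => lt_asymm hn (hh.2 x)⟩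
  by_cases hcase : ∀ n, (H n).Nonempty
  · refine ⟨H, fun n => ⟨?_, fun h hh => hh.1⟩, ?_⟩
    · intro hfin
      have : ∀ h : Cp X, ∃ k, h ∈ A → h ∉ H k := by
        intro h
        by_cases hA : h ∈ A
        · obtain ⟨k, hk⟩ := hHout h hA
          exact ⟨k, fun _ => hk⟩
        · exact ⟨0, fun h => absurd h hA⟩
      choose k hk using this
      let M := n + hfin.toFinset.sup k
      obtain ⟨h, hh⟩ := hcase M
      have h1 : h ∈ H n := hHanti n M (Nat.le_add_right _ _) hh
      have h2 : k h ≤ hfin.toFinset.sup k := Finset.le_sup (hfin.mem_toFinset.2 h1)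
      exact hk h hh.1 (hHanti (k h) M (h2.trans (Nat.le_add_left _ _)) hh)
    · intro U hU
      obtain ⟨F, ε, h0, hF⟩ := pk_nhds_elim y hU
      obtain ⟨n, hn⟩ := exists_nat_one_div_lt h0
      exact ⟨n, fun h hh => hF h (fun x _ => (hh.2 x).trans hn)⟩
  push Not at hcase
  obtain ⟨N, hN⟩ := hcase
  have hsep : ∀ (n : ℕ) (h : Cp X), ∃ C, IsClopen C ∧
      (∀ x, |h.1 x - y.1 x| ≤ 1 / ((n : ℝ) + 1) / 2 → x ∈ C) ∧
      ∀ x ∈ C, |h.1 x - y.1 x| < 1 / ((n : ℝ) + 1) := by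
    intro n h
    have hpos : 0 < 1 / ((n : ℝ) + 1) := Nat.one_div_pos_of_nat
    have hcont : Continuous (fun x => |h.1 x - y.1 x|) := (h.2.sub y.2).abs
    obtain ⟨C, hC, h1, h2⟩ := pk_separate hz hP {x | |h.1 x - y.1 x| ≤ 1 / ((n : ℝ) + 1) / 2}
      {x | 1 / ((n : ℝ) + 1) ≤ |h.1 x - y.1 x|} (isClosed_le hcont continuous_const)
      (isClosed_le continuous_const hcont) (by
        rw [Set.disjoint_left]
        intro x hx hx2
        simp only [Set.mem_ofPred_eq] at hx hx2
        linarith)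
    refine ⟨C, hC, fun x hx => h1 hx, fun x hx => ?_⟩
    have := Set.disjoint_left.1 h2 hx
    simpa using this
  choose V hV hV1 hV2 using hsep
  let c : ℕ → Cp X → CpS X ({0, 1} : Set ℝ) := fun n h => pkInd (V n h) (hV n h)
  have hpy : ∀ n, N ≤ n → ∃ B : ℕ → Set (CpS X ({0, 1} : Set ℝ)),
      (∀ m, (B m).Infinite ∧ B m ⊆ c n '' A) ∧ ∀ U ∈ 𝓝 (pkZero X), ∃ m, B m ⊆ U := by
    intro n hn
    apply hP
    constructor
    · apply pk_mem_closure
      intro F ε h0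
      have hpos : 0 < 1 / ((n : ℝ) + 1) := Nat.one_div_pos_of_nat
      obtain ⟨h, hA, hF⟩ := pk_of_closure y hy.1 F (half_pos hpos)
      refine ⟨c n h, ⟨h, hA, rfl⟩, fun x hx => ?_⟩
      rw [pkInd_zero _ (hV1 n h x (hF x hx).le)]
      simpa [pkZero] using h0
    · rintro ⟨h, hA, hh⟩
      have : h ∈ H N := by
        apply hHanti N n hn
        refine ⟨hA, fun x => hV2 n h x (pkInd_lt (hV n h) ?_)⟩
        change (c n h).1 x < 1
        rw [hh]
        exact one_pos
      rw [hN] at this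
      exact this
  choose B hB hBU using fun n => hpy (N + n) (Nat.le_add_right _ _)
  refine ⟨fun k => {h | h ∈ A ∧ c (N + k.unpair.1) h ∈ B k.unpair.1 k.unpair.2},
    fun k => ⟨?_, fun h hh => hh.1⟩, ?_⟩
  · intro hfin
    apply (hB k.unpair.1 k.unpair.2).1
    refine (hfin.image (c (N + k.unpair.1))).subset ?_
    intro b hb
    obtain ⟨h, hA, rfl⟩ := (hB k.unpair.1 k.unpair.2).2 hb
    exact ⟨h, ⟨hA, hb⟩, rfl⟩
  · intro U hU
    obtain ⟨F, ε, h0, hF⟩ := pk_nhds_elim y hU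
    obtain ⟨n, hn⟩ := exists_nat_one_div_lt h0
    obtain ⟨m, hm⟩ := hBU n _ (pk_nhds_intro (pkZero X) F one_pos)
    refine ⟨Nat.pair n m, ?_⟩
    simp only [Nat.unpair_pair]
    rintro h ⟨hA, hh⟩
    apply hF h
    intro x hx
    have h1 := (abs_lt.1 (hm hh x hx)).2
    have h2 : x ∈ V (N + n) h := pkInd_lt (hV _ _) (by simpa [pkZero] using h1)
    refine (hV2 _ _ x h2).trans (lt_of_le_of_lt ?_ hn)
    exact Nat.one_div_le_one_div (Nat.le_add_left _ _)

/-- Mesh size. -/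
def pkN (n : ℕ) : ℕ := 8 * (n + 1) ^ 2

noncomputable def pkF (n : ℕ) (T : Finset ℕ) (r : ℝ) : ℝ :=
  ∏ t ∈ T, min 1 (max 0 ((pkN n : ℝ) * |r - t / pkN n| - 1))

theorem pkN_pos (n : ℕ) : (0 : ℝ) < pkN n := by
  unfold pkN; positivity

theorem pkF_cont (n : ℕ) (T : Finset ℕ) : Continuous (pkF n T) := by
  unfold pkF; fun_prop

theorem pkF_vol (n : ℕ) (T : Finset ℕ) (hT : T.card ≤ n) :
    MeasureTheory.volume {r | pkF n T r < 1} ≤ ENNReal.ofReal (1 / ((n : ℝ) + 1) / 2) := by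
  have hN := pkN_pos n
  have hsub : {r | pkF n T r < 1} ⊆ ⋃ t ∈ T, Metric.ball ((t : ℝ) / pkN n) (2 / pkN n) := by
    intro r hr
    by_contra hcon
    simp only [Set.mem_iUnion, not_exists, Metric.mem_ball, not_lt, Real.dist_eq] at hcon
    have : pkF n T r = 1 := by
      apply Finset.prod_eq_one
      intro t ht
      have h1 := hcon t ht
      rw [div_le_iff₀ hN] at h1
      rw [min_eq_left]
      apply le_max_of_le_right
      linarith
    have hr' : pkF n T r < 1 := hr
    linarith
  calc MeasureTheory.volume {r | pkF n T r < 1}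
      ≤ MeasureTheory.volume (⋃ t ∈ T, Metric.ball ((t : ℝ) / pkN n) (2 / pkN n)) :=
        MeasureTheory.measure_mono hsub
    _ ≤ ∑ t ∈ T, MeasureTheory.volume (Metric.ball ((t : ℝ) / pkN n) (2 / pkN n)) :=
        MeasureTheory.measure_biUnion_finset_le _ _
    _ = T.card * ENNReal.ofReal (2 * (2 / pkN n)) := by
        simp [Real.volume_ball]
    _ = ENNReal.ofReal (T.card * (2 * (2 / pkN n))) := by
        rw [ENNReal.ofReal_mul (Nat.cast_nonneg T.card), ENNReal.ofReal_natCast]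
    _ ≤ _ := by
        apply ENNReal.ofReal_le_ofReal
        have h1 : (T.card : ℝ) ≤ n := by exact_mod_cast hT
        have h2 : (T.card : ℝ) * (2 * (2 / pkN n)) ≤ ((n : ℝ) + 1) * (2 * (2 / pkN n)) := by
          gcongr
          linarith
        refine h2.trans (le_of_eq ?_)
        unfold pkN
        push_cast
        field_simp
        norm_num

theorem pk_no_onto {X : Type*} [TopologicalSpace X] (hP : PytkeevProp (Cp X))
    (h : X → ℝ) (hc : Continuous h) (h01 : ∀ x, 0 ≤ h x ∧ h x ≤ 1)
    (hon : ∀ r, 0 < r → r < 1 → ∃ x, h x = r) : False := by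
  classical
  let g : ℕ → Finset ℕ → Cp X := fun n T => ⟨fun x => pkF n T (h x), (pkF_cont n T).comp hc⟩
  let ok : ℕ → Finset ℕ → Prop := fun n T => T ⊆ Finset.range (pkN n + 1) ∧ T.card ≤ n
  let A : Set (Cp X) := {f | ∃ n T, ok n T ∧ f = g n T}
  let y : Cp X := ⟨fun _ => 0, continuous_const⟩
  have hpick : ∀ E : Set ℝ, MeasureTheory.volume E < 1 → ∃ x, h x ∉ E := by
    intro E hE
    by_contra hcon
    push Not at hcon
    have : Set.Ioo (0 : ℝ) 1 ⊆ E := by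
      intro r hr
      obtain ⟨x, rfl⟩ := hon r hr.1 hr.2
      exact hcon x
    have := MeasureTheory.measure_mono (μ := MeasureTheory.volume) this
    rw [Real.volume_Ioo] at this
    simp at this
    exact absurd hE (not_lt.2 this)
  obtain ⟨B, hB, hBU⟩ := hP A y ⟨by
    apply pk_mem_closure
    intro F ε h0
    have hN := pkN_pos F.card
    refine ⟨g F.card (F.image fun x => ⌊(pkN F.card : ℝ) * h x⌋₊),
      ⟨_, _, ⟨?_, Finset.card_image_le⟩, rfl⟩, ?_⟩
    · intro t ht
      obtain ⟨x, _, rfl⟩ := Finset.mem_image.1 ht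
      rw [Finset.mem_range, Nat.lt_succ_iff]
      apply Nat.floor_le_of_le
      nlinarith [(h01 x).2]
    · intro x hx
      have : (g F.card (F.image fun x => ⌊(pkN F.card : ℝ) * h x⌋₊)).1 x = 0 := by
        apply Finset.prod_eq_zero (Finset.mem_image_of_mem _ hx)
        rw [max_eq_left]
        · simp
        · have hnn : 0 ≤ (pkN F.card : ℝ) * h x := mul_nonneg hN.le (h01 x).1
          have h1 := Nat.floor_le hnn
          have h2 := Nat.lt_floor_add_one ((pkN F.card : ℝ) * h x)
          set k : ℝ := (⌊(pkN F.card : ℝ) * h x⌋₊ : ℝ) with hk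
          have h3 : (pkN F.card : ℝ) * |h x - k / pkN F.card| = |pkN F.card * h x - k| := by
            rw [← abs_of_pos hN, ← abs_mul, abs_of_pos hN]
            congr 1
            field_simp
          rw [h3, abs_of_nonneg (by linarith)]
          linarith
      rw [this]
      simpa [y] using h0, by
    rintro ⟨n, T, hok, he⟩
    obtain ⟨x, hx⟩ := hpick {r | pkF n T r < 1} (by
      refine (pkF_vol n T hok.2).trans_lt ?_
      rw [ENNReal.ofReal_lt_one]
      have : 1 / ((n : ℝ) + 1) ≤ 1 := by
        have := Nat.one_div_le_one_div (α := ℝ) (Nat.zero_le n)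
        simpa using this
      linarith)
    apply hx
    change (g n T).1 x < 1
    rw [← he]
    exact one_pos⟩
  let E : ℕ → Set ℝ := fun k => {r | ∀ n T, ok n T → g n T ∈ B k → pkF n T r < 1}
  have hE : ∀ k, MeasureTheory.volume (E k) = 0 := by
    intro k
    have hlarge : ∀ M, ∃ n T, M ≤ n ∧ ok n T ∧ g n T ∈ B k := by
      intro M
      by_contra hcon
      push Not at hcon
      apply (hB k).1
      refine ((Finset.range M).biUnion fun n =>
        (Finset.range (pkN n + 1)).powerset.image (g n)).finite_toSet.subset ?_
      intro f hf
      obtain ⟨n, T, hok, rfl⟩ := (hB k).2 hf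
      have hn : n < M := by
        by_contra hn
        exact hcon n T (not_lt.1 hn) hok hf
      simp only [Finset.mem_coe, Finset.mem_biUnion, Finset.mem_range, Finset.mem_image,
        Finset.mem_powerset]
      exact ⟨n, hn, T, hok.1, rfl⟩
    have hle : ∀ M : ℕ, MeasureTheory.volume (E k) ≤ ENNReal.ofReal (1 / ((M : ℝ) + 1)) := by
      intro M
      obtain ⟨n, T, hMn, hok, hg⟩ := hlarge M
      have hs : E k ⊆ {r | pkF n T r < 1} := fun r hr => hr n T hok hg
      refine (MeasureTheory.measure_mono hs).trans ((pkF_vol n T hok.2).trans ?_)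
      apply ENNReal.ofReal_le_ofReal
      have h1 : 1 / ((n : ℝ) + 1) ≤ 1 / ((M : ℝ) + 1) := Nat.one_div_le_one_div hMn
      have h2 : 0 < 1 / ((n : ℝ) + 1) := Nat.one_div_pos_of_nat
      linarith
    have hlim : Tendsto (fun M : ℕ => ENNReal.ofReal (1 / ((M : ℝ) + 1))) atTop (𝓝 0) := by
      have := ENNReal.tendsto_ofReal (tendsto_one_div_add_atTop_nhds_zero_nat (𝕜 := ℝ))
      simpa using this
    exact le_antisymm (ge_of_tendsto' hlim hle) zero_le
  obtain ⟨x, hx⟩ := hpick (⋃ k, E k) (by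
    rw [MeasureTheory.measure_iUnion_null hE]
    exact one_pos)
  obtain ⟨k, hk⟩ := hBU _ (pk_nhds_intro y {x} one_pos)
  apply hx
  refine Set.mem_iUnion.2 ⟨k, fun n T _ hg => ?_⟩
  have h1 := (abs_lt.1 (hk hg x (by simp))).2
  simpa [y, g] using h1

theorem pk_zeroDim {X : Type*} [TopologicalSpace X] [CompletelyRegularSpace X]
    (hP : PytkeevProp (Cp X)) : ZeroDimensionalSpace X := by
  intro x U hU
  obtain ⟨O, hOU, hO, hxO⟩ := mem_nhds_iff.1 hU
  obtain ⟨f, hf, hfx, hfK⟩ := CompletelyRegularSpace.completely_regular x Oᶜ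
    hO.isClosed_compl (by simpa using hxO)
  by_contra hcon
  have hfc : Continuous (fun z => (f z : ℝ)) := continuous_subtype_val.comp hf
  refine pk_no_onto hP (fun z => (f z : ℝ)) hfc (fun z => ⟨(f z).2.1, (f z).2.2⟩) ?_
  intro r h0 h1
  by_contra hr
  push Not at hr
  apply hcon
  refine ⟨{z | (f z : ℝ) < r}, ⟨?_, isOpen_lt hfc continuous_const⟩, by simpa [hfx] using h0, ?_⟩
  · have : {z | (f z : ℝ) < r} = {z | (f z : ℝ) ≤ r} := by
      ext z
      simp only [Set.mem_ofPred_eq]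
      exact ⟨fun h => le_of_lt h, fun h => lt_of_le_of_ne h (hr z)⟩
    rw [this]
    exact isClosed_le hfc continuous_const
  · intro z hz
    by_contra hzU
    have h2 : f z = 1 := hfK (fun hzO => hzU (hOU hzO))
    simp only [Set.mem_ofPred_eq, h2] at hz
    have h3 : (1 : ℝ) < r := hz
    linarith

/-- for a Tychonoff space `X`, the Pytkeev property of `C_p(X)`,
of `C_p(X,S₀)` (with zero-dimensionality), and of `C_p(X,{0,1})` (with
zero-dimensionality) are equivalent. -/
theorem statement14 (X : Type*) [TopologicalSpace X] [T2Space X]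
    [CompletelyRegularSpace X] :
    (PytkeevProp (Cp X) ↔
      (ZeroDimensionalSpace X ∧ PytkeevProp (CpS X Szero))) ∧
    (PytkeevProp (Cp X) ↔
      (ZeroDimensionalSpace X ∧ PytkeevProp (CpS X ({0, 1} : Set ℝ)))) := by
  have h01 : PytkeevProp (CpS X Szero) → PytkeevProp (CpS X ({0, 1} : Set ℝ)) := by
    apply pk_mono
    rintro f ⟨hf, hS⟩
    refine ⟨hf, fun x => ?_⟩
    rcases hS x with h | h
    · exact Or.inr h
    · refine Or.inl ⟨0, ?_⟩
      have h' : f x = 1 := h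
      rw [h']
      norm_num
  have hsub : ∀ S : Set ℝ, PytkeevProp (Cp X) → PytkeevProp (CpS X S) := by
    intro S
    exact pk_mono (fun f hf => hf.1)
  exact ⟨⟨fun h => ⟨pk_zeroDim h, hsub _ h⟩, fun h => pk_main h.1 (h01 h.2)⟩,
    ⟨fun h => ⟨pk_zeroDim h, hsub _ h⟩, fun h => pk_main h.1 h.2⟩⟩
end

section
/- If X is a zero-dimensional topological space such that every clopen ω-cover of X contains a countable ω-cover of X, then X is Lindelöf. -/
open Set Topology Filter

/-- a zero-dimensional space in which every clopen ω-cover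
contains a countable ω-cover is Lindelöf. -/
theorem statement15 (X : Type*) [TopologicalSpace X]
    (hz : ZeroDimensionalSpace X)
    (h : ∀ 𝒰 : Set (Set X), (∀ U ∈ 𝒰, IsClopen U) → IsOmegaCover 𝒰 →
      ∃ 𝒱 ⊆ 𝒰, 𝒱.Countable ∧ IsOmegaCover 𝒱) :
    LindelofSpace X := by
  constructor
  refine isLindelof_of_countable_subcover ?_
  intro ι U hUo hcov
  by_cases hfin : ∃ t : Finset ι, (univ : Set X) ⊆ ⋃ i ∈ t, U i
  · obtain ⟨t, ht⟩ := hfin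
    exact ⟨(t : Set ι), t.countable_toSet, by simpa using ht⟩
  · obtain ⟨𝒱, hsub, hc, -, hV⟩ := h {W | IsClopen W ∧ ∃ t : Finset ι, W ⊆ ⋃ i ∈ t, U i}
      (fun W hW => hW.1) ⟨fun hu => hfin hu.2, by
        intro F hF
        induction F, hF using Set.Finite.induction_on with
        | empty => exact ⟨∅, ⟨isClopen_empty, ∅, empty_subset _⟩, empty_subset _⟩
        | @insert a s _ _ ih =>
          classical
          obtain ⟨W, ⟨hW, t, ht⟩, hs⟩ := ih
          obtain ⟨i, hi⟩ := mem_iUnion.1 (hcov (mem_univ a))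
          obtain ⟨V, hVc, haV, hVU⟩ := hz a (U i) ((hUo i).mem_nhds hi)
          refine ⟨V ∪ W, ⟨hVc.union hW, insert i t, ?_⟩, ?_⟩
          · rw [Finset.set_biUnion_insert]
            exact union_subset_union hVU ht
          · exact insert_subset (Or.inl haV) (hs.trans subset_union_right)⟩
    choose! t ht using fun W (hW : W ∈ 𝒱) => (hsub hW).2
    refine ⟨⋃ W ∈ 𝒱, (t W : Set ι), hc.biUnion fun W _ => (t W).countable_toSet, ?_⟩
    intro x _
    obtain ⟨W, hW, hx⟩ := hV {x} (finite_singleton x)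
    obtain ⟨i, hi, hxi⟩ := mem_iUnion₂.1 (ht W hW (hx rfl))
    exact mem_iUnion₂.2 ⟨i, mem_iUnion₂.2 ⟨W, hW, hi⟩, hxi⟩
end

section
/- Let X be a zero-dimensional Tychonoff space. The following are equivalent: (1) C_p(X) has the Pytkeev property; (2) every clopen ω-cover of X contains a countable ω-cover of X, and for every continuous map Ψ : X → [ℕ]^ω whose image ℱ is free (⋂ℱ = ∅) and centered, there is a partition ⟨ℱ⟩ = ⋃_{n∈ℕ} ℱₙ of the closure ⟨ℱ⟩ of ℱ under finite intersections such that each ℱₙ has a pseudo-intersection; (3) every clopen ω-cover 𝒰 of X contains infinite subsets 𝒰₁, 𝒰₂, … such that the family {⋂𝒰ₙ : n ∈ ℕ} is an ω-cover of X. -/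
open Set Topology Filter

theorem aux_count {X : Type*} [TopologicalSpace X]
    (h3 : ∀ 𝒰 : Set (Set X), (∀ U ∈ 𝒰, IsClopen U) → IsOmegaCover 𝒰 →
        ∃ 𝒱 : ℕ → Set (Set X), (∀ n, 𝒱 n ⊆ 𝒰 ∧ (𝒱 n).Infinite) ∧
          IsOmegaCover (Set.range fun n => ⋂₀ 𝒱 n)) :
    ∀ 𝒰 : Set (Set X), (∀ U ∈ 𝒰, IsClopen U) → IsOmegaCover 𝒰 →
          ∃ 𝒱 ⊆ 𝒰, 𝒱.Countable ∧ IsOmegaCover 𝒱 := by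
  intro 𝒰 hcl hω
  obtain ⟨𝒱, hV, hVω⟩ := h3 𝒰 hcl hω
  choose g hg using fun n => (hV n).2.nonempty
  have hsub : Set.range g ⊆ 𝒰 := by
    rintro _ ⟨n, rfl⟩
    exact (hV n).1 (hg n)
  refine ⟨Set.range g, hsub, Set.countable_range g, fun h => hω.1 (hsub h), fun F hF => ?_⟩
  obtain ⟨_, ⟨n, rfl⟩, hn⟩ := hVω.2 F hF
  exact ⟨g n, ⟨n, rfl⟩, hn.trans (Set.sInter_subset_of_mem (hg n))⟩

/-- the members of an ω-cover containing a given finite set form an infinite family -/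
theorem aux_inf {X : Type*} {𝒰 : Set (Set X)} (h : IsOmegaCover 𝒰) (F : Set X)
    (hF : F.Finite) : {U ∈ 𝒰 | F ⊆ U}.Infinite := by
  intro hfin
  have hne : ∀ U : Set X, ∃ x : Set X, x.Finite ∧ (U ∈ 𝒰 → ¬ x ⊆ U) := by
    intro U
    by_cases hU : U ∈ 𝒰
    · have : U ≠ univ := fun e => h.1 (e ▸ hU)
      obtain ⟨x, hx⟩ := (Set.ne_univ_iff_exists_notMem U).1 this
      exact ⟨{x}, Set.finite_singleton x, fun _ hs => hx (hs rfl)⟩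
    · exact ⟨∅, Set.finite_empty, fun h => absurd h hU⟩
  choose x hxf hx using hne
  obtain ⟨U, hU, hFU⟩ := h.2 (F ∪ ⋃ U ∈ {U ∈ 𝒰 | F ⊆ U}, x U)
    (hF.union (hfin.biUnion fun U _ => hxf U))
  have hmem : U ∈ {U ∈ 𝒰 | F ⊆ U} := ⟨hU, subset_union_left.trans hFU⟩
  apply hx U hU
  exact (Set.subset_biUnion_of_mem (u := x) hmem).trans (subset_union_right.trans hFU)

theorem aux_sep {X : Type*} [TopologicalSpace X] (hz : ZeroDimensionalSpace X)
    (hc : ∀ 𝒰 : Set (Set X), (∀ U ∈ 𝒰, IsClopen U) → IsOmegaCover 𝒰 →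
          ∃ 𝒱 ⊆ 𝒰, 𝒱.Countable ∧ IsOmegaCover 𝒱)
    (C D : Set X) (hC : IsClosed C) (hD : IsClosed D) (hCD : Disjoint C D) :
    ∃ W, IsClopen W ∧ C ⊆ W ∧ Disjoint W D := by
  let P : Set X → Prop := fun V => IsClopen V ∧ (Disjoint V C ∨ Disjoint V D)
  have hpt : ∀ x, ∃ V, P V ∧ x ∈ V := by
    intro x
    by_cases hx : x ∈ C
    · have hxD : x ∉ D := fun h => Set.disjoint_left.1 hCD hx h
      obtain ⟨V, hV, hxV, hs⟩ := hz x Dᶜ (hD.isOpen_compl.mem_nhds hxD)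
      exact ⟨V, ⟨hV, Or.inr (Set.disjoint_left.2 fun a ha => hs ha)⟩, hxV⟩
    · obtain ⟨V, hV, hxV, hs⟩ := hz x Cᶜ (hC.isOpen_compl.mem_nhds hx)
      exact ⟨V, ⟨hV, Or.inl (Set.disjoint_left.2 fun a ha => hs ha)⟩, hxV⟩
  choose V hVP hxV using hpt
  let 𝒰 : Set (Set X) := {U | ∃ F : Set X, F.Finite ∧ U = ⋃ x ∈ F, V x}
  have hcov : ∃ 𝒯 : Set X, 𝒯.Countable ∧ ∀ y, ∃ x ∈ 𝒯, y ∈ V x := by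
    by_cases hu : univ ∈ 𝒰
    · obtain ⟨F, hF, hFu⟩ := hu
      refine ⟨F, hF.countable, fun y => ?_⟩
      have : y ∈ ⋃ x ∈ F, V x := hFu ▸ mem_univ y
      simpa using this
    · obtain ⟨𝒱, hsub, hcnt, hω⟩ := hc 𝒰 (by
        rintro _ ⟨F, hF, rfl⟩
        exact hF.isClopen_biUnion fun x _ => (hVP x).1) ⟨hu, fun F hF =>
          ⟨_, ⟨F, hF, rfl⟩, fun x hx => Set.mem_biUnion hx (hxV x)⟩⟩
      have hsub' : ∀ U : Set X, ∃ F : Set X, U ∈ 𝒱 → F.Finite ∧ U = ⋃ x ∈ F, V x := by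
        intro U
        by_cases hU : U ∈ 𝒱
        · obtain ⟨F, hF⟩ := hsub hU
          exact ⟨F, fun _ => hF⟩
        · exact ⟨∅, fun h => absurd h hU⟩
      choose S hS using hsub'
      refine ⟨⋃ U ∈ 𝒱, S U, hcnt.biUnion fun U hU => (hS U hU).1.countable, fun y => ?_⟩
      obtain ⟨U, hU, hy⟩ := hω.2 {y} (Set.finite_singleton y)
      have hyU : y ∈ U := hy rfl
      rw [(hS U hU).2] at hyU
      simp only [mem_iUnion] at hyU
      obtain ⟨x, hx, hyx⟩ := hyU
      exact ⟨x, Set.mem_biUnion hU hx, hyx⟩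
  obtain ⟨𝒯, hTc, hT⟩ := hcov
  obtain hX | hX := isEmpty_or_nonempty X
  · exact ⟨∅, isClopen_empty, fun x => (hX.false x).elim, by simp⟩
  have hne : 𝒯.Nonempty := by
    obtain ⟨x, hx, _⟩ := hT (Classical.arbitrary X)
    exact ⟨x, hx⟩
  obtain ⟨t, ht⟩ := hTc.exists_eq_range hne
  let B : ℕ → Set X := fun n => V (t n)
  have hBU : ∀ y, ∃ n, y ∈ disjointed B n := by
    intro y
    obtain ⟨x, hx, hy⟩ := hT y
    rw [ht] at hx
    obtain ⟨n, rfl⟩ := hx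
    have : y ∈ ⋃ n, disjointed B n := by
      rw [iUnion_disjointed]
      exact mem_iUnion.2 ⟨n, hy⟩
    exact mem_iUnion.1 this
  have hopen : ∀ n, IsOpen (disjointed B n) := by
    intro n
    have : IsClopen (disjointed B n) :=
      disjointedRec (p := IsClopen) (fun _ i hs => hs.diff (hVP (t i)).1) (hVP (t n)).1
    exact this.isOpen
  have hdis := disjoint_disjointed B
  refine ⟨⋃ n ∈ {n | Disjoint (B n) D}, disjointed B n, ⟨?_, ?_⟩, ?_, ?_⟩
  · have : (⋃ n ∈ {n | Disjoint (B n) D}, disjointed B n)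
        = (⋃ n ∈ {n | ¬ Disjoint (B n) D}, disjointed B n)ᶜ := by
      ext y
      obtain ⟨n, hn⟩ := hBU y
      have huniq : ∀ m, y ∈ disjointed B m → m = n := by
        intro m hm
        by_contra hmn
        exact Set.disjoint_left.1 (hdis hmn) hm hn
      simp only [mem_iUnion, mem_compl_iff, mem_ofPred_eq, not_exists]
      constructor
      · rintro ⟨m, hm, hym⟩ k hk hyk
        rw [huniq m hym] at hm
        rw [huniq k hyk] at hk
        exact hk hm
      · intro h
        refine ⟨n, ?_, hn⟩
        by_contra hh
        exact h n hh hn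
    rw [this]
    exact (isOpen_biUnion fun n _ => hopen n).isClosed_compl
  · exact isOpen_biUnion fun n _ => hopen n
  · intro y hy
    obtain ⟨n, hn⟩ := hBU y
    refine Set.mem_biUnion (x := n) ?_ hn
    rcases (hVP (t n)).2 with h | h
    · exact absurd hy (Set.disjoint_left.1 h (disjointed_subset B n hn))
    · exact h
  · rw [Set.disjoint_iUnion₂_left]
    intro n hn
    exact Disjoint.mono_left (disjointed_subset B n) hn

theorem aux_nhds1 {X : Type*} [TopologicalSpace X] (y : Cp X) (F : Set X) (hF : F.Finite)
    (ε : ℝ) (hε : 0 < ε) : {f : Cp X | ∀ x ∈ F, |f.1 x - y.1 x| < ε} ∈ 𝓝 y := by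
  have : ∀ᶠ f : Cp X in 𝓝 y, ∀ x ∈ F, |f.1 x - y.1 x| < ε := by
    rw [Filter.eventually_all_finite hF]
    intro x _
    have hcont : Continuous fun f : Cp X => |f.1 x - y.1 x| :=
      (((continuous_apply x).comp continuous_subtype_val).sub continuous_const).abs
    have := hcont.tendsto y
    exact this.eventually_lt_const (by simpa using hε)
  exact this

theorem aux_nhds2 {X : Type*} [TopologicalSpace X] (y : Cp X) (U : Set (Cp X)) (hU : U ∈ 𝓝 y) :
    ∃ F : Set X, F.Finite ∧ ∃ ε : ℝ, 0 < ε ∧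
      ∀ f : Cp X, (∀ x ∈ F, |f.1 x - y.1 x| < ε) → f ∈ U := by
  rw [nhds_subtype_eq_comap, Filter.mem_comap] at hU
  obtain ⟨u, hu, hsub⟩ := hU
  rw [nhds_pi, Filter.mem_pi] at hu
  obtain ⟨I, hI, t, ht, hts⟩ := hu
  have h1 : ∀ᶠ ε in 𝓝[>] (0:ℝ), ∀ x ∈ I, Metric.ball (y.1 x) ε ⊆ t x := by
    rw [Filter.eventually_all_finite hI]
    intro x _
    obtain ⟨ε, hε, hb⟩ := Metric.mem_nhds_iff.1 (ht x)
    filter_upwards [Ioo_mem_nhdsGT hε] with δ hδ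
    exact (Metric.ball_subset_ball hδ.2.le).trans hb
  obtain ⟨ε, hε, hpos⟩ := (h1.and self_mem_nhdsWithin).exists
  refine ⟨I, hI, ε, hpos, fun f hf => hsub (hts fun x hx => hε x hx ?_)⟩
  rw [Metric.mem_ball, Real.dist_eq]
  exact hf x hx

theorem aux_13 {X : Type*} [TopologicalSpace X] (h1 : PytkeevProp (Cp X)) :
    ∀ 𝒰 : Set (Set X), (∀ U ∈ 𝒰, IsClopen U) → IsOmegaCover 𝒰 →
        ∃ 𝒱 : ℕ → Set (Set X), (∀ n, 𝒱 n ⊆ 𝒰 ∧ (𝒱 n).Infinite) ∧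
          IsOmegaCover (Set.range fun n => ⋂₀ 𝒱 n) := by
  classical
  intro 𝒰 hcl hω
  let A : Set (Cp X) := {f | ∃ U ∈ 𝒰, f.1 = Set.indicator Uᶜ (fun _ => (1:ℝ))}
  let z : Cp X := ⟨fun _ => 0, continuous_const⟩
  have hz : z ∈ closure A \ A := by
    constructor
    · rw [mem_closure_iff_nhds]
      intro N hN
      obtain ⟨F, hF, ε, hε, hf⟩ := aux_nhds2 z N hN
      obtain ⟨U, hU, hFU⟩ := hω.2 F hF
      have hcont : Continuous (Set.indicator Uᶜ (fun _ => (1:ℝ))) :=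
        (continuous_const).indicator (by simp [(hcl U hU).compl.frontier_eq])
      refine ⟨⟨_, hcont⟩, hf _ fun x hx => ?_, U, hU, rfl⟩
      have : x ∈ U := hFU hx
      simpa [z, this] using hε
    · rintro ⟨U, hU, he⟩
      apply hω.1
      convert hU
      symm
      rw [Set.eq_univ_iff_forall]
      intro x
      by_contra hx
      have := congrFun he x
      simp [z, hx] at this
  obtain ⟨𝒜, hA, hN⟩ := h1 A z hz
  have hA2 : ∀ n, {U ∈ 𝒰 | ∃ f ∈ 𝒜 n, f.1 = Set.indicator Uᶜ (fun _ => (1:ℝ))}.Infinite := by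
    intro n hfin
    apply (hA n).1
    refine Set.Finite.of_finite_image (f := Subtype.val) ?_ Subtype.val_injective.injOn
    refine (hfin.image fun U => Set.indicator Uᶜ (fun _ => (1:ℝ))).subset ?_
    rintro _ ⟨f, hf, rfl⟩
    obtain ⟨U, hU, he⟩ := (hA n).2 hf
    exact ⟨U, ⟨hU, f, hf, he⟩, he.symm⟩
  refine ⟨_, fun n => ⟨Set.sep_subset _ _, hA2 n⟩, ?_, ?_⟩
  · rintro ⟨n, hn⟩
    obtain ⟨U, hU⟩ := (hA2 n).nonempty
    have : U = univ := Set.eq_univ_of_univ_subset (hn ▸ Set.sInter_subset_of_mem hU)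
    exact hω.1 (this ▸ hU.1)
  · intro F hF
    obtain ⟨n, hn⟩ := hN _ (aux_nhds1 z F hF 1 one_pos)
    refine ⟨_, ⟨n, rfl⟩, ?_⟩
    rintro x hx U ⟨hU, f, hf, he⟩
    by_contra hxU
    have := hn hf x hx
    rw [he] at this
    simp [z, hxU] at this

theorem aux_31 {X : Type*} [TopologicalSpace X] (hz : ZeroDimensionalSpace X)
    (h3 : ∀ 𝒰 : Set (Set X), (∀ U ∈ 𝒰, IsClopen U) → IsOmegaCover 𝒰 →
        ∃ 𝒱 : ℕ → Set (Set X), (∀ n, 𝒱 n ⊆ 𝒰 ∧ (𝒱 n).Infinite) ∧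
          IsOmegaCover (Set.range fun n => ⋂₀ 𝒱 n)) : PytkeevProp (Cp X) := by
  intro A y hy
  by_cases hcase : ∀ n : ℕ, ∃ f ∈ A, ∀ x, |f.1 x - y.1 x| < 1 / ((n:ℝ) + 1)
  · choose f hfA hf using hcase
    refine ⟨fun n => f '' Set.Ici n, fun n => ⟨?_, ?_⟩, ?_⟩
    · intro hfin
      have hex : ∃ g ∈ f '' Set.Ici n, {m | m ∈ Set.Ici n ∧ f m = g}.Infinite := by
        by_contra hcon
        push Not at hcon
        have : (Set.Ici n).Finite := by
          refine (hfin.biUnion hcon).subset fun m hm => ?_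
          exact Set.mem_biUnion (Set.mem_image_of_mem f hm) ⟨hm, rfl⟩
        exact Set.Ici_infinite n this
      obtain ⟨g, ⟨k, _, hk⟩, hinf⟩ := hex
      have hgy : g = y := by
        apply Subtype.ext
        funext x
        by_contra hne
        have hpos : 0 < |g.1 x - y.1 x| := abs_pos.2 (sub_ne_zero.2 hne)
        obtain ⟨N, hN⟩ := exists_nat_one_div_lt hpos
        obtain ⟨m, ⟨_, hm⟩, hmN⟩ := hinf.exists_gt N
        have h1 := hf m x
        rw [hm] at h1
        have h2 := Nat.one_div_le_one_div (α := ℝ) hmN.le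
        linarith
      apply hy.2
      rw [← hgy, ← hk]
      exact hfA k
    · rintro _ ⟨m, _, rfl⟩
      exact hfA m
    · intro U hU
      obtain ⟨F, hF, ε, hε, hfU⟩ := aux_nhds2 y U hU
      obtain ⟨N, hN⟩ := exists_nat_one_div_lt hε
      refine ⟨N, ?_⟩
      rintro _ ⟨m, hm, rfl⟩
      apply hfU
      intro x _
      have h2 := Nat.one_div_le_one_div (α := ℝ) (show N ≤ m from hm)
      have h1 := hf m x
      linarith
  · push Not at hcase
    obtain ⟨N, hN⟩ := hcase
    have hW : ∀ (n : ℕ) (f : Cp X), ∃ W : Set X, IsClopen W ∧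
        (∀ x, |f.1 x - y.1 x| ≤ 1 / ((n:ℝ) + 1) / 2 → x ∈ W) ∧
        ∀ x ∈ W, |f.1 x - y.1 x| < 1 / ((n:ℝ) + 1) := by
      intro n f
      have hcont : Continuous fun x => |f.1 x - y.1 x| := (f.2.sub y.2).abs
      have hpos : (0:ℝ) < 1 / ((n:ℝ) + 1) := Nat.one_div_pos_of_nat
      obtain ⟨W, hW, hCW, hWD⟩ := aux_sep hz (aux_count h3)
        {x | |f.1 x - y.1 x| ≤ 1 / ((n:ℝ) + 1) / 2} {x | 1 / ((n:ℝ) + 1) ≤ |f.1 x - y.1 x|}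
        (isClosed_le hcont continuous_const) (isClosed_le continuous_const hcont)
        (Set.disjoint_left.2 fun x hx hx' => by
          rw [Set.mem_ofPred_eq] at hx hx'
          linarith)
      refine ⟨W, hW, fun x hx => hCW hx, fun x hx => ?_⟩
      by_contra hcon
      exact Set.disjoint_left.1 hWD hx (not_lt.1 hcon)
    choose W hWc hW1 hW2 using hW
    have hω : ∀ n : ℕ, IsOmegaCover (W (N + n) '' A) := by
      intro n
      constructor
      · rintro ⟨f, hf, he⟩
        obtain ⟨x, hx⟩ := hN f hf
        have h1 := hW2 (N + n) f x (he ▸ mem_univ x)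
        have h2 := Nat.one_div_le_one_div (α := ℝ) (Nat.le_add_right N n)
        linarith
      · intro F hF
        have hpos : (0:ℝ) < 1 / (((N + n : ℕ):ℝ) + 1) := Nat.one_div_pos_of_nat
        obtain ⟨f, hf, hfA⟩ := mem_closure_iff_nhds.1 hy.1 _
          (aux_nhds1 y F hF (1 / (((N + n : ℕ):ℝ) + 1) / 2) (by linarith))
        exact ⟨_, ⟨f, hfA, rfl⟩, fun x hx => hW1 _ _ _ (hf x hx).le⟩
    choose 𝒱 hV hVω using fun n => h3 (W (N + n) '' A)
      (by rintro _ ⟨f, _, rfl⟩; exact hWc _ _) (hω n)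
    let 𝒜 : ℕ → ℕ → Set (Cp X) := fun n k => {f ∈ A | W (N + n) f ∈ 𝒱 n k}
    refine ⟨fun p => 𝒜 p.unpair.1 p.unpair.2, fun p => ⟨?_, Set.sep_subset _ _⟩, ?_⟩
    · intro hfin
      apply (hV p.unpair.1 p.unpair.2).2
      refine (hfin.image (W (N + p.unpair.1))).subset fun U hU => ?_
      obtain ⟨f, hf, rfl⟩ := (hV p.unpair.1 p.unpair.2).1 hU
      exact ⟨f, ⟨hf, hU⟩, rfl⟩
    · intro U hU
      obtain ⟨F, hF, ε, hε, hfU⟩ := aux_nhds2 y U hU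
      obtain ⟨n, hn⟩ := exists_nat_one_div_lt hε
      obtain ⟨_, ⟨k, rfl⟩, hk⟩ := (hVω n).2 F hF
      refine ⟨Nat.pair n k, ?_⟩
      simp only [Nat.unpair_pair]
      rintro f ⟨_, hf⟩
      apply hfU
      intro x hx
      have h1 := hW2 (N + n) f x (hk hx _ hf)
      have h2 := Nat.one_div_le_one_div (α := ℝ) (Nat.le_add_left n N)
      linarith

theorem aux_32 {X : Type*} [TopologicalSpace X]
    (h3 : ∀ 𝒰 : Set (Set X), (∀ U ∈ 𝒰, IsClopen U) → IsOmegaCover 𝒰 →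
        ∃ 𝒱 : ℕ → Set (Set X), (∀ n, 𝒱 n ⊆ 𝒰 ∧ (𝒱 n).Infinite) ∧
          IsOmegaCover (Set.range fun n => ⋂₀ 𝒱 n)) :
    ∀ Ψ : X → ℕ → Bool, Continuous Ψ →
          (∀ x, {n | Ψ x n = true}.Infinite) →
          ⋂₀ (Set.range fun x => {n | Ψ x n = true}) = ∅ →
          IsCentered (Set.range fun x => {n | Ψ x n = true}) →
          ∃ 𝒬 : ℕ → Set (Set ℕ),
            (⋃ n, 𝒬 n) = FinInterClosure (Set.range fun x => {n | Ψ x n = true}) ∧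
            ∀ n, ∃ A, IsPseudoIntersection A (𝒬 n) := by
  intro Ψ hΨ hinf hfree hcent
  let U : ℕ → Set X := fun n => {x | Ψ x n = true}
  have hX : Nonempty X := by
    by_contra hcon
    rw [not_nonempty_iff] at hcon
    simp at hfree
  have hω : IsOmegaCover (Set.range U) := by
    constructor
    · rintro ⟨n, hn⟩
      have : n ∈ ⋂₀ (Set.range fun x => {n | Ψ x n = true}) := by
        rintro _ ⟨x, rfl⟩
        have : x ∈ U n := hn ▸ mem_univ x
        exact this
      rw [hfree] at this
      exact this
    · intro F hF
      obtain ⟨x0⟩ := hX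
      obtain ⟨n, hn⟩ := (hcent ((fun x => {n | Ψ x n = true}) '' (insert x0 F))
        (Set.image_subset_range _ _) ((hF.insert x0).image _)
        ((Set.insert_nonempty _ _).image _)).nonempty
      refine ⟨_, ⟨n, rfl⟩, fun x hx => ?_⟩
      exact hn _ ⟨x, Set.mem_insert_of_mem _ hx, rfl⟩
  obtain ⟨𝒱, hV, hVω⟩ := h3 (Set.range U) (by
    rintro _ ⟨n, rfl⟩
    have hc : Continuous fun x => Ψ x n := (continuous_apply n).comp hΨ
    exact (isClopen_discrete {true}).preimage hc) hω
  refine ⟨fun k => {B ∈ FinInterClosure (Set.range fun x => {n | Ψ x n = true}) |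
    {n | U n ∈ 𝒱 k} ⊆ B}, ?_, ?_⟩
  · apply Set.Subset.antisymm
    · exact Set.iUnion_subset fun k => Set.sep_subset _ _
    · intro B hB
      obtain ⟨𝒢, hG, hGf, hGn, rfl⟩ := id hB
      obtain ⟨F, hF, rfl⟩ : ∃ F : Set X, F.Finite ∧ (fun x => {n | Ψ x n = true}) '' F = 𝒢 := by
        obtain ⟨F, _, hF, he⟩ := Set.exists_subset_image_finite_and.1
          ⟨𝒢, by rwa [Set.image_univ], hGf, rfl⟩
        exact ⟨F, hF, he.symm⟩
      obtain ⟨_, ⟨k, rfl⟩, hk⟩ := hVω.2 F hF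
      refine Set.mem_iUnion.2 ⟨k, hB, ?_⟩
      rintro n hn _ ⟨x, hx, rfl⟩
      exact hk hx _ hn
  · intro k
    refine ⟨{n | U n ∈ 𝒱 k}, ?_, ?_⟩
    · intro hfin
      apply (hV k).2
      refine (hfin.image U).subset fun S hS => ?_
      obtain ⟨n, rfl⟩ := (hV k).1 hS
      exact ⟨n, hS, rfl⟩
    · rintro B ⟨_, hB⟩
      rw [Set.sdiff_eq_empty.2 hB]
      exact Set.finite_empty

theorem aux_23 {X : Type*} [TopologicalSpace X]
    (hc : ∀ 𝒰 : Set (Set X), (∀ U ∈ 𝒰, IsClopen U) → IsOmegaCover 𝒰 →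
          ∃ 𝒱 ⊆ 𝒰, 𝒱.Countable ∧ IsOmegaCover 𝒱)
    (h2 : ∀ Ψ : X → ℕ → Bool, Continuous Ψ →
          (∀ x, {n | Ψ x n = true}.Infinite) →
          ⋂₀ (Set.range fun x => {n | Ψ x n = true}) = ∅ →
          IsCentered (Set.range fun x => {n | Ψ x n = true}) →
          ∃ 𝒬 : ℕ → Set (Set ℕ),
            (⋃ n, 𝒬 n) = FinInterClosure (Set.range fun x => {n | Ψ x n = true}) ∧
            ∀ n, ∃ A, IsPseudoIntersection A (𝒬 n)) :
    ∀ 𝒰 : Set (Set X), (∀ U ∈ 𝒰, IsClopen U) → IsOmegaCover 𝒰 →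
        ∃ 𝒱 : ℕ → Set (Set X), (∀ n, 𝒱 n ⊆ 𝒰 ∧ (𝒱 n).Infinite) ∧
          IsOmegaCover (Set.range fun n => ⋂₀ 𝒱 n) := by
  classical
  intro 𝒰 hcl hω
  obtain ⟨𝒯, hsub, hcnt, hTω⟩ := hc 𝒰 hcl hω
  have hTinf : 𝒯.Infinite := fun h =>
    aux_inf hTω ∅ Set.finite_empty (h.subset (Set.sep_subset _ _))
  have := hcnt.to_subtype
  have := hTinf.to_subtype
  obtain ⟨e⟩ := nonempty_equiv_of_countable (α := ℕ) (β := 𝒯)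
  let U : ℕ → Set X := fun n => (e n : Set X)
  have hUinj : Function.Injective U := Subtype.val_injective.comp e.injective
  have hUT : ∀ n, U n ∈ 𝒯 := fun n => (e n).2
  have hUsurj : ∀ S ∈ 𝒯, ∃ n, U n = S := fun S hS => ⟨e.symm ⟨S, hS⟩, by simp [U]⟩
  have hinf : ∀ F : Set X, F.Finite → {n | F ⊆ U n}.Infinite := by
    intro F hF hfin
    apply aux_inf hTω F hF
    refine (hfin.image U).subset ?_
    rintro S ⟨hS, hFS⟩
    obtain ⟨n, rfl⟩ := hUsurj S hS
    exact ⟨n, hFS, rfl⟩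
  have hX : Nonempty X := by
    by_contra hcon
    rw [not_nonempty_iff] at hcon
    obtain ⟨S, hS, _⟩ := hω.2 ∅ Set.finite_empty
    exact hω.1 (Subsingleton.elim S univ ▸ hS)
  let Ψ : X → ℕ → Bool := fun x n => decide (x ∈ U n)
  have hmem : ∀ x n, Ψ x n = true ↔ x ∈ U n := fun x n => decide_eq_true_iff
  have hfin : ∀ 𝒢 ⊆ Set.range (fun x => {n | Ψ x n = true}), 𝒢.Finite →
      ∃ F : Set X, F.Finite ∧ ⋂₀ 𝒢 = {n | F ⊆ U n} := by
    intro 𝒢 hG hGf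
    obtain ⟨F, _, hF, he⟩ := Set.exists_subset_image_finite_and.1
      ⟨𝒢, by rwa [Set.image_univ], hGf, rfl⟩
    refine ⟨F, hF, ?_⟩
    rw [he]
    ext n
    simp [hmem, Set.subset_def]
  obtain ⟨𝒬, hQ, hA⟩ := h2 Ψ (by
      refine continuous_pi fun n => ?_
      rw [continuous_discrete_rng]
      intro b
      have hcU := hcl _ (hsub (hUT n))
      cases b
      · convert hcU.compl.isOpen using 1
        ext x
        simp [Ψ]
      · convert hcU.isOpen using 1
        ext x
        simp [Ψ]) (by
      intro x
      have := hinf {x} (Set.finite_singleton x)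
      simpa [hmem] using this) (by
      rw [Set.eq_empty_iff_forall_notMem]
      intro n hn
      apply hTω.1
      have : U n = univ := by
        rw [Set.eq_univ_iff_forall]
        intro x
        exact (hmem x n).1 (hn _ ⟨x, rfl⟩)
      exact this ▸ hUT n) (by
      intro 𝒢 hG hGf _
      obtain ⟨F, hF, he⟩ := hfin 𝒢 hG hGf
      rw [he]
      exact hinf F hF)
  choose A hAinf hA using hA
  have hVinf : ∀ p : ℕ, (U '' {j ∈ A p.unpair.1 | p.unpair.2 < j}).Infinite := by
    intro p
    refine Set.Infinite.image hUinj.injOn ?_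
    intro hfn
    apply hAinf p.unpair.1
    refine (hfn.union (Set.finite_Iic p.unpair.2)).subset fun j hj => ?_
    by_cases h : p.unpair.2 < j
    · exact Or.inl ⟨hj, h⟩
    · exact Or.inr (not_lt.1 h)
  have hVsub : ∀ p : ℕ, U '' {j ∈ A p.unpair.1 | p.unpair.2 < j} ⊆ 𝒰 := by
    rintro p _ ⟨j, _, rfl⟩
    exact hsub (hUT j)
  refine ⟨fun p => U '' {j ∈ A p.unpair.1 | p.unpair.2 < j}, fun p => ⟨hVsub p, hVinf p⟩, ?_, ?_⟩
  · rintro ⟨p, hp⟩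
    obtain ⟨S, hS⟩ := (hVinf p).nonempty
    have : S = univ := Set.eq_univ_of_univ_subset (hp ▸ Set.sInter_subset_of_mem hS)
    exact hω.1 (this ▸ hVsub p hS)
  · intro F hF
    obtain ⟨x0⟩ := hX
    have hB : ⋂₀ ((fun x => {n | Ψ x n = true}) '' (insert x0 F)) ∈ ⋃ n, 𝒬 n := by
      rw [hQ]
      exact ⟨_, Set.image_subset_range _ _, (hF.insert x0).image _,
        (Set.insert_nonempty _ _).image _, rfl⟩
    obtain ⟨n, hn⟩ := Set.mem_iUnion.1 hB
    obtain ⟨m, hm⟩ := (hA n _ hn).bddAbove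
    refine ⟨_, ⟨Nat.pair n m, rfl⟩, ?_⟩
    simp only [Nat.unpair_pair]
    rintro x hx _ ⟨j, ⟨hj, hmj⟩, rfl⟩
    by_contra hxj
    have : j ≤ m := hm ⟨hj, fun hjB => hxj
      ((hmem x j).1 (hjB _ ⟨x, Set.mem_insert_of_mem _ hx, rfl⟩))⟩
    omega

/-- characterizations of the Pytkeev property of `C_p(X)` for
zero-dimensional Tychonoff `X`. -/
theorem statement16 (X : Type*) [TopologicalSpace X] [T2Space X]
    [CompletelyRegularSpace X] (hz : ZeroDimensionalSpace X) :
    (PytkeevProp (Cp X) ↔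
      ((∀ 𝒰 : Set (Set X), (∀ U ∈ 𝒰, IsClopen U) → IsOmegaCover 𝒰 →
          ∃ 𝒱 ⊆ 𝒰, 𝒱.Countable ∧ IsOmegaCover 𝒱) ∧
        ∀ Ψ : X → ℕ → Bool, Continuous Ψ →
          (∀ x, {n | Ψ x n = true}.Infinite) →
          ⋂₀ (Set.range fun x => {n | Ψ x n = true}) = ∅ →
          IsCentered (Set.range fun x => {n | Ψ x n = true}) →
          ∃ 𝒬 : ℕ → Set (Set ℕ),
            (⋃ n, 𝒬 n) = FinInterClosure (Set.range fun x => {n | Ψ x n = true}) ∧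
            ∀ n, ∃ A, IsPseudoIntersection A (𝒬 n))) ∧
    (PytkeevProp (Cp X) ↔
      ∀ 𝒰 : Set (Set X), (∀ U ∈ 𝒰, IsClopen U) → IsOmegaCover 𝒰 →
        ∃ 𝒱 : ℕ → Set (Set X), (∀ n, 𝒱 n ⊆ 𝒰 ∧ (𝒱 n).Infinite) ∧
          IsOmegaCover (Set.range fun n => ⋂₀ 𝒱 n)) := by
  have h13 := aux_13 (X := X)
  have h31 := aux_31 hz
  refine ⟨⟨fun h => ⟨aux_count (h13 h), aux_32 (h13 h)⟩, fun h => h31 (aux_23 h.1 h.2)⟩,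
    ⟨h13, h31⟩⟩
end

section
/- If X ⊆ ℝ and C_p(X) has the Pytkeev property, then X has strong measure zero. -/
open Set Topology Filter

noncomputable def pyBump (r : ℝ) (T : Finset ℝ) (x : ℝ) : ℝ := ∏ t ∈ T, max 0 (|x - t| / r - 1)

lemma pyBump_cont (r : ℝ) (T : Finset ℝ) : Continuous (pyBump r T) := by
  unfold pyBump; fun_prop

lemma pyBump_lt {r : ℝ} (hr : 0 < r) {T : Finset ℝ} {x : ℝ} (h : pyBump r T x < 1) :
    ∃ t ∈ T, |x - t| < 2 * r := by
  by_contra! hc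
  refine absurd h (not_lt.2 ?_)
  unfold pyBump
  have : ∏ t ∈ T, (1 : ℝ) ≤ ∏ t ∈ T, max 0 (|x - t| / r - 1) := by
    refine Finset.prod_le_prod (fun _ _ => zero_le_one) fun t ht => ?_
    refine le_max_of_le_right ?_
    have := (le_div_iff₀ hr).2 (hc t ht)
    linarith
  simpa using this

lemma pyBump_zero {r : ℝ} (hr : 0 < r) {T : Finset ℝ} {x t : ℝ} (ht : t ∈ T) (h : |x - t| < r) :
    pyBump r T x = 0 := by
  refine Finset.prod_eq_zero ht (max_eq_left ?_)
  have := (div_lt_one hr).2 h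
  linarith

lemma py_enum (T : Finset ℝ) : ∃ g : ℕ → ℝ, ∀ t ∈ T, ∃ i < T.card, g i = t := by
  refine ⟨fun i => T.toList.getD i 0, fun t ht => ?_⟩
  obtain ⟨i, hi, h⟩ := List.getElem_of_mem (Finset.mem_toList.2 ht)
  refine ⟨i, by simpa using hi, ?_⟩
  exact (List.getD_eq_getElem _ _ hi).trans h

lemma py_delta (ε : ℕ → ℝ) (hε : ∀ n, 0 < ε n) (k : ℕ) :
    ∃ r : ℝ, 0 < r ∧ ∀ n ≤ k, ∀ i ≤ k, 4 * r < ε (Nat.pair n i) := by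
  have h : ∀ᶠ r : ℝ in 𝓝[>] 0, ∀ n ∈ Set.Iic k, ∀ i ∈ Set.Iic k, 4 * r < ε (Nat.pair n i) := by
    rw [Filter.eventually_all_finite (Set.finite_Iic k)]
    intro n _
    rw [Filter.eventually_all_finite (Set.finite_Iic k)]
    intro i _
    refine Filter.Eventually.filter_mono nhdsWithin_le_nhds ?_
    have : Continuous fun r : ℝ => 4 * r := by fun_prop
    exact this.continuousAt.eventually_lt_const (by simpa using hε _)
  obtain ⟨r, h1, h2⟩ := (h.and self_mem_nhdsWithin).exists
  exact ⟨r, h2, h1⟩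

lemma py_grid (r : ℝ) (hr : 0 < r) (k : ℕ) :
    ∃ G : Finset ℝ, ∀ x : ℝ, |x| ≤ k → ∃ t ∈ G, |x - t| < r := by
  obtain ⟨t, -, ht, h⟩ := (isCompact_Icc (a := -(k : ℝ)) (b := k)).finite_cover_balls hr
  refine ⟨ht.toFinset, fun x hx => ?_⟩
  have := h (abs_le.1 hx)
  simpa [Real.dist_eq] using this

/-- Miller: if `X ⊆ ℝ` and `C_p(X)` has the Pytkeev property,
then `X` has strong measure zero. -/
theorem statement17 (X : Set ℝ) (h : PytkeevProp (Cp X)) :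
    ∀ ε : ℕ → ℝ, (∀ n, 0 < ε n) →
      ∃ I : ℕ → Set ℝ, (∀ x ∈ X, ∃ n, x ∈ I n) ∧
        ∀ n, EMetric.diam (I n) < ENNReal.ofReal (ε n) := by
  intro ε hε
  choose r hr hrε using py_delta ε hε
  choose G hG using fun k => py_grid (r k) (hr k) k
  let c : ℕ → ℝ := fun k => 1 / ((k : ℝ) + 1)
  have hc : ∀ k, 0 < c k := fun k => by positivity
  let φ : ℕ → Finset ℝ → Cp X := fun k T =>
    ⟨fun x => pyBump (r k) T x + c k,
      ((pyBump_cont (r k) T).comp continuous_subtype_val).add continuous_const⟩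
  let S : ℕ → Set (Finset ℝ) := fun k => {T | T ⊆ G k ∧ T.card ≤ k}
  have hS : ∀ k, (S k).Finite := fun k =>
    ((G k).powerset.finite_toSet).subset fun T hT => by simpa using hT.1
  let A : Set (Cp X) := ⋃ k, Set.image (φ k) (S k)
  let z : Cp X := ⟨fun _ => 0, continuous_const⟩
  have hpos : ∀ (k : ℕ) (T : Finset ℝ) (x : ℝ), 0 ≤ pyBump (r k) T x := fun k T x =>
    Finset.prod_nonneg fun _ _ => le_max_left _ _
  by_cases hX : X.Nonempty
  swap
  · refine ⟨fun _ => ∅, fun x hx => absurd ⟨x, hx⟩ hX, fun n => ?_⟩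
    exact lt_of_eq_of_lt Metric.ediam_empty (ENNReal.ofReal_pos.2 (hε n))
  obtain ⟨x₀, hx₀⟩ := hX
  have hzA : z ∉ A := by
    intro hz
    obtain ⟨k, T, -, hT⟩ := Set.mem_iUnion.1 hz
    have h1 : pyBump (r k) T x₀ + c k = 0 := congrFun (congrArg Subtype.val hT) ⟨x₀, hx₀⟩
    have := hpos k T x₀
    have := hc k
    linarith
  have hzcl : z ∈ closure A := by
    rw [mem_closure_iff_nhds]
    intro U hU
    rw [nhds_induced, Filter.mem_comap] at hU
    obtain ⟨V, hV, hVU⟩ := hU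
    rw [nhds_pi, Filter.mem_pi] at hV
    obtain ⟨F, hF, t, ht, htV⟩ := hV
    have e1 : ∀ᶠ k in atTop, ∀ x ∈ F, c k ∈ t x := by
      rw [Filter.eventually_all_finite hF]
      intro x _
      exact tendsto_one_div_add_atTop_nhds_zero_nat (𝕜 := ℝ) (ht x)
    have e2 : ∀ᶠ k : ℕ in atTop, ∀ x ∈ F, |(x : ℝ)| ≤ k := by
      rw [Filter.eventually_all_finite hF]
      intro x _
      exact tendsto_natCast_atTop_atTop.eventually_ge_atTop _
    obtain ⟨k, ⟨h1, h2⟩, h3⟩ := ((e1.and e2).and (eventually_ge_atTop hF.toFinset.card)).exists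
    have h4 : ∀ x : X, ∃ t, x ∈ F → t ∈ G k ∧ |(x : ℝ) - t| < r k := by
      intro x
      by_cases hx : x ∈ F
      · obtain ⟨t, h⟩ := hG k x (h2 x hx)
        exact ⟨t, fun _ => h⟩
      · exact ⟨0, fun h => absurd h hx⟩
    choose p hp using h4
    classical
    refine ⟨φ k (hF.toFinset.image p), hVU (htV ?_), Set.mem_iUnion.2 ⟨k, _, ⟨?_, ?_⟩, rfl⟩⟩
    · intro x hx
      change pyBump (r k) (hF.toFinset.image p) x + c k ∈ t x
      rw [pyBump_zero (hr k) (t := p x)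
        (Finset.mem_image_of_mem _ (hF.mem_toFinset.2 hx)) (hp x hx).2, zero_add]
      exact h1 x hx
    · intro y hy
      obtain ⟨x, hx, rfl⟩ := Finset.mem_image.1 hy
      exact (hp x (hF.mem_toFinset.1 hx)).1
    · exact Finset.card_image_le.trans h3
  obtain ⟨𝒜, h𝒜, hU⟩ := h A z ⟨hzcl, hzA⟩
  have key : ∀ n, ∃ k T, n ≤ k ∧ T ∈ S k ∧ φ k T ∈ 𝒜 n := by
    intro n
    by_contra! hcon
    refine (h𝒜 n).1 (Set.Finite.subset
      ((Set.finite_Iio n).biUnion fun k _ => (hS k).image (φ k)) ?_)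
    intro f hf
    obtain ⟨k, T, hT, rfl⟩ := Set.mem_iUnion.1 ((h𝒜 n).2 hf)
    have : k < n := by
      by_contra hk
      exact hcon k T (not_lt.1 hk) hT hf
    exact Set.mem_biUnion this ⟨T, hT, rfl⟩
  choose k T hnk hT hφ using key
  choose g hg using fun n => py_enum (T n)
  refine ⟨fun m => if (Nat.unpair m).2 ≤ k (Nat.unpair m).1 then
    Metric.ball (g (Nat.unpair m).1 (Nat.unpair m).2) (2 * r (k (Nat.unpair m).1)) else ∅, ?_, ?_⟩
  · intro x hx
    have hcont : Continuous fun f : Cp X => f.1 ⟨x, hx⟩ :=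
      (continuous_apply _).comp continuous_subtype_val
    have hn : {f : Cp X | f.1 ⟨x, hx⟩ < 1} ∈ 𝓝 z :=
      (isOpen_lt hcont continuous_const).mem_nhds (by simp [z])
    obtain ⟨n, hn⟩ := hU _ hn
    have h1 : pyBump (r (k n)) (T n) x + c (k n) < 1 := hn (hφ n)
    obtain ⟨t, ht, hxt⟩ := pyBump_lt (hr (k n)) (T := T n) (x := x) (by linarith [hc (k n)])
    obtain ⟨i, hi, rfl⟩ := hg n t ht
    refine ⟨Nat.pair n i, ?_⟩
    have : i ≤ k n := hi.le.trans (hT n).2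
    simpa [this, Real.dist_eq] using hxt
  · intro m
    dsimp only
    split_ifs with hm
    · have h1 := hrε _ _ (hnk (Nat.unpair m).1) _ hm
      rw [Nat.pair_unpair] at h1
      rw [Real.ball_eq_Ioo]
      refine lt_of_eq_of_lt (Real.ediam_Ioo _ _) ?_
      refine (ENNReal.ofReal_lt_ofReal_iff (hε m)).2 ?_
      linarith
    · exact lt_of_eq_of_lt Metric.ediam_empty (ENNReal.ofReal_pos.2 (hε m))
end

section
/- Let X be a zero-dimensional Tychonoff space. The following are equivalent: (1) C_p(X) has the Reznichenko property; (2) every clopen ω-cover of X contains a countable ω-cover of X, and no continuous image of X in [ℕ]^ω is a subbase for a nonfeeble filter on ℕ; (3) every clopen ω-cover of X contains an ω-groupable cover of X. -/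
open Set Topology Filter

namespace S18

lemma mem_nhds_Cp {X : Type*} [TopologicalSpace X] (f : Cp X) (E : Set X) (hE : E.Finite)
    (ε : ℝ) (hε : 0 < ε) : {g : Cp X | ∀ x ∈ E, |g.1 x - f.1 x| < ε} ∈ 𝓝 f := by
  have : {g : Cp X | ∀ x ∈ E, |g.1 x - f.1 x| < ε} = ⋂ x ∈ E, {g : Cp X | |g.1 x - f.1 x| < ε} := by
    ext g; simp
  rw [this, Filter.biInter_mem hE]
  intro x _
  have hc : Continuous fun g : Cp X => |g.1 x - f.1 x| := by
    have : Continuous fun g : Cp X => g.1 x := (continuous_apply x).comp continuous_subtype_val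
    exact (this.sub continuous_const).abs
  apply (isOpen_lt hc continuous_const).mem_nhds
  simpa using hε

lemma nhds_Cp {X : Type*} [TopologicalSpace X] (f : Cp X) (U : Set (Cp X)) (hU : U ∈ 𝓝 f) :
    ∃ E : Set X, E.Finite ∧ ∃ ε : ℝ, 0 < ε ∧ ∀ g : Cp X, (∀ x ∈ E, |g.1 x - f.1 x| < ε) → g ∈ U := by
  obtain ⟨t, ht, htU⟩ := (mem_nhds_induced (Subtype.val : Cp X → X → ℝ) f U).1 hU
  rw [nhds_pi, Filter.mem_pi] at ht
  obtain ⟨I, hI, s, hs, hst⟩ := ht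
  have : ∀ x, ∃ ε > 0, Metric.ball (f.1 x) ε ⊆ s x := fun x => Metric.mem_nhds_iff.1 (hs x)
  choose ε hε hb using this
  obtain ⟨δ, hδ, hle⟩ : ∃ δ > 0, ∀ x ∈ I, δ ≤ ε x := by
    clear hst
    induction I, hI using Set.Finite.induction_on with
    | empty => exact ⟨1, one_pos, by simp⟩
    | insert _ _ ih =>
      obtain ⟨δ, hδ, h⟩ := ih
      rename_i a s _ _
      refine ⟨min δ (ε a), lt_min hδ (hε a), ?_⟩
      rintro x (rfl | hx)
      · exact min_le_right _ _
      · exact (min_le_left _ _).trans (h x hx)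
  refine ⟨I, hI, δ, hδ, fun g hg => htU (hst fun x hx => hb x ?_)⟩
  rw [Metric.mem_ball, Real.dist_eq]
  exact (hg x hx).trans_le (hle x hx)

lemma one_three {X : Type*} [TopologicalSpace X] (h : ReznichenkoProp (Cp X)) :
    ∀ 𝒰 : Set (Set X), (∀ U ∈ 𝒰, IsClopen U) → IsOmegaCover 𝒰 →
        ∃ 𝒱 ⊆ 𝒰, (∀ x : X, ∃ U ∈ 𝒱, x ∈ U) ∧ IsOmegaGroupable 𝒱 := by
  classical
  intro 𝒰 hcl hω
  let A : Set (Cp X) := {g | {x | g.1 x = 0} ∈ 𝒰 ∧ ∀ x, g.1 x = 0 ∨ g.1 x = 1}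
  let f : Cp X := ⟨fun _ => 0, continuous_const⟩
  have hf : f ∈ closure A \ A := by
    constructor
    · rw [mem_closure_iff_nhds]
      intro t ht
      obtain ⟨E, hE, ε, hε, hg⟩ := nhds_Cp f t ht
      obtain ⟨U, hU, hEU⟩ := hω.2 E hE
      refine ⟨⟨U.indicator (fun _ => (0:ℝ)) + Uᶜ.indicator (fun _ => 1), ?_⟩, hg _ ?_, ?_, ?_⟩
      · exact (continuous_const.indicator (by simp [(hcl U hU).frontier_eq])).add
          (continuous_const.indicator (by simp [(hcl U hU).frontier_eq]))
      · intro x hx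
        simp [hEU hx, f, hε]
      · convert hU
        ext x
        by_cases hx : x ∈ U <;> simp [hx]
      · intro x
        by_cases hx : x ∈ U <;> simp [hx]
    · intro hfA
      apply hω.1
      simpa [A, f] using hfA.1
  obtain ⟨F, hF, hd, hU⟩ := h A f hf
  let z : Cp X → Set X := fun g => {x | g.1 x = 0}
  have hzinj : ∀ g ∈ A, ∀ g' ∈ A, z g = z g' → g = g' := by
    intro g hg g' hg' he
    apply Subtype.ext
    funext x
    have : x ∈ z g ↔ x ∈ z g' := by rw [he]
    simp only [z, mem_ofPred_eq] at this
    rcases hg.2 x with h1 | h1 <;> rcases hg'.2 x with h2 | h2 <;> simp_all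
  have key : ∀ E : Set X, E.Finite → ∀ᶠ n in atTop, ∃ U ∈ z '' F n, E ⊆ U := by
    intro E hE
    filter_upwards [hU _ (mem_nhds_Cp f E hE 1 one_pos)] with n ⟨g, hg, hgE⟩
    refine ⟨_, mem_image_of_mem _ hg, fun x hx => ?_⟩
    have := hgE x hx
    rcases ((hF n).1 hg).2 x with h | h
    · exact h
    · simp [f, h] at this
  refine ⟨⋃ n, z '' F n, ?_, ?_, range fun n => z '' F n, ?_, ?_, ?_, ?_⟩
  · simp only [iUnion_subset_iff]
    rintro n _ ⟨g, hg, rfl⟩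
    exact ((hF n).1 hg).1
  · intro x
    obtain ⟨n, U, hU, hx⟩ := (key {x} (finite_singleton x)).exists
    exact ⟨U, mem_iUnion_of_mem n hU, hx rfl⟩
  · rintro _ ⟨n, rfl⟩
    exact (hF n).2.image _
  · rintro _ ⟨n, rfl⟩ _ ⟨m, rfl⟩ hne
    have hnm : n ≠ m := by rintro rfl; exact hne rfl
    simp only [Function.onFun, id]
    rw [Set.disjoint_left]
    rintro _ ⟨g, hg, rfl⟩ ⟨g', hg', he⟩
    have := hzinj _ ((hF m).1 hg') _ ((hF n).1 hg) he
    subst this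
    exact (Set.disjoint_left.1 (hd n m hnm)) hg hg'
  · rw [sUnion_range]
  · intro E hE
    have := key E hE
    rw [← Nat.cofinite_eq_atTop, Filter.eventually_cofinite] at this
    apply (this.image fun n => z '' F n).subset
    rintro _ ⟨⟨n, rfl⟩, hn⟩
    exact ⟨n, hn, rfl⟩

end S18
namespace S18

def Two_a (X : Type*) [TopologicalSpace X] : Prop :=
  ∀ 𝒰 : Set (Set X), (∀ U ∈ 𝒰, IsClopen U) → IsOmegaCover 𝒰 →
          ∃ 𝒱 ⊆ 𝒰, 𝒱.Countable ∧ IsOmegaCover 𝒱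

def Two_b (X : Type*) [TopologicalSpace X] : Prop :=
  ∀ Ψ : X → ℕ → Bool, Continuous Ψ →
    (∀ E : Set X, E.Finite → {n | ∀ x ∈ E, Ψ x n = true}.Infinite) →
    ∃ h : ℕ → ℕ, StrictMono h ∧ ∀ E : Set X, E.Finite → ∀ᶠ n in atTop,
      ∃ j, h n ≤ j ∧ j < h (n + 1) ∧ ∀ x ∈ E, Ψ x j = true

def Two_b0 (X : Type*) [TopologicalSpace X] : Prop :=
        ∀ Ψ : X → ℕ → Bool, Continuous Ψ →
          (∀ x, {n | Ψ x n = true}.Infinite) →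
          ∀ F : Filter ℕ,
            F = Filter.generate (Set.range fun x => {n | Ψ x n = true}) →
            F ≠ ⊥ → (∀ a : Set ℕ, F ≠ Filter.principal a) →
            ∃ h : ℕ → ℕ, StrictMono h ∧
              ∀ a ∈ F, ∀ᶠ n in Filter.atTop,
                (a ∩ Set.Ico (h n) (h (n + 1))).Nonempty

lemma mem_gen {X : Type*} (Ψ : X → ℕ → Bool) (a : Set ℕ) :
    a ∈ Filter.generate (Set.range fun x => {n | Ψ x n = true}) ↔
      ∃ E : Set X, E.Finite ∧ {n | ∀ x ∈ E, Ψ x n = true} ⊆ a := by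
  rw [Filter.mem_generate_iff]
  constructor
  · rintro ⟨t, ht, htf, hta⟩
    obtain ⟨E, rfl⟩ := Set.subset_range_iff_exists_image_eq.1 ht
    obtain ⟨E', _, hb⟩ := Set.exists_subset_bijOn E (fun x => {n | Ψ x n = true})
    refine ⟨E', Set.Finite.of_finite_image (by rw [hb.image_eq]; exact htf) hb.injOn, ?_⟩
    refine Subset.trans ?_ hta
    intro n hn
    rw [← hb.image_eq]
    rintro _ ⟨x, hx, rfl⟩
    exact hn x hx
  · rintro ⟨E, hE, h⟩
    refine ⟨(fun x => {n | Ψ x n = true}) '' E, image_subset_range _ _, hE.image _, ?_⟩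
    refine Subset.trans ?_ h
    intro n hn x hx
    exact hn _ (mem_image_of_mem _ hx)

lemma b_of_b0 {X : Type*} [TopologicalSpace X] (h : Two_b0 X) : Two_b X := by
  intro Ψ hΨ hc
  have hinf : ∀ a ∈ Filter.generate (Set.range fun x => {n | Ψ x n = true}), a.Infinite := by
    intro a ha
    obtain ⟨E, hE, hEa⟩ := (mem_gen Ψ a).1 ha
    exact (hc E hE).mono hEa
  by_cases hp : ∃ a, Filter.generate (Set.range fun x => {n | Ψ x n = true}) = 𝓟 a
  · obtain ⟨a, ha⟩ := hp
    have hai := hinf a (by rw [ha]; exact mem_principal_self a)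
    refine ⟨Nat.nth (· ∈ a), Nat.nth_strictMono hai, fun E hE => Eventually.of_forall fun n => ?_⟩
    refine ⟨Nat.nth (· ∈ a) n, le_rfl, Nat.nth_strictMono hai (Nat.lt_succ_self n), ?_⟩
    have : {n | ∀ x ∈ E, Ψ x n = true} ∈ 𝓟 a := by
      rw [← ha]; exact (mem_gen Ψ _).2 ⟨E, hE, Subset.rfl⟩
    exact this (Nat.nth_mem_of_infinite hai n)
  · push Not at hp
    obtain ⟨k, hk, hk'⟩ := h Ψ hΨ (fun x => by simpa using hc {x} (finite_singleton x)) _ rfl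
      (fun hb => hp ∅ (by rw [hb, principal_empty])) hp
    refine ⟨k, hk, fun E hE => ?_⟩
    filter_upwards [hk' _ ((mem_gen Ψ _).2 ⟨E, hE, Subset.rfl⟩)] with n ⟨j, hj, hj'⟩
    exact ⟨j, hj'.1, hj'.2, hj⟩

lemma b0_of_b {X : Type*} [TopologicalSpace X] (h : Two_b X) : Two_b0 X := by
  intro Ψ hΨ _ F hF hb hp
  have hinf : ∀ a ∈ F, a.Infinite := by
    intro a ha hfin
    have hex : ∃ n, ∃ b ∈ F, b.Finite ∧ b.ncard = n := ⟨_, a, ha, hfin, rfl⟩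
    classical
    obtain ⟨b, hbF, hbf, hbn⟩ := Nat.find_spec hex
    apply hp b
    apply le_antisymm
    · rwa [le_principal_iff]
    · intro c hc
      rw [mem_principal]
      have h1 : b ∩ c ∈ F := inter_mem hbF hc
      have h2 := Nat.find_min' hex ⟨b ∩ c, h1, hbf.subset inter_subset_left, rfl⟩
      rw [← hbn] at h2
      have := Set.eq_of_subset_of_ncard_le inter_subset_left h2 hbf
      exact inter_eq_left.1 this
  subst hF
  obtain ⟨k, hk, hk'⟩ := h Ψ hΨ fun E hE => hinf _ ((mem_gen Ψ _).2 ⟨E, hE, Subset.rfl⟩)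
  refine ⟨k, hk, fun a ha => ?_⟩
  obtain ⟨E, hE, hEa⟩ := (mem_gen Ψ a).1 ha
  filter_upwards [hk' E hE] with n ⟨j, h1, h2, h3⟩
  exact ⟨j, hEa h3, h1, h2⟩

/-- separation -/
lemma sep {X : Type*} [TopologicalSpace X] (hz : ZeroDimensionalSpace X) (ha : Two_a X)
    (φ : X → ℝ) (hφ : Continuous φ) (a b : ℝ) (hab : a < b) :
    ∃ C : Set X, IsClopen C ∧ (∀ x, φ x ≤ a → x ∈ C) ∧ ∀ x ∈ C, φ x < b := by
  let good : Set (Set X) := {O | IsClopen O ∧ ∃ C, IsClopen C ∧ C ⊆ O ∧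
    (∀ x ∈ O, φ x ≤ a → x ∈ C) ∧ ∀ x ∈ C, φ x < b}
  have hun : ∀ O ∈ good, ∀ O' ∈ good, O ∪ O' ∈ good := by
    rintro O ⟨hO, C, hC, hCO, h1, h2⟩ O' ⟨hO', C', hC', hCO', h1', h2'⟩
    refine ⟨hO.union hO', C ∪ C', hC.union hC', union_subset_union hCO hCO', ?_, ?_⟩
    · rintro x (hx | hx) h
      · exact Or.inl (h1 x hx h)
      · exact Or.inr (h1' x hx h)
    · rintro x (hx | hx)
      · exact h2 x hx
      · exact h2' x hx
  have hpt : ∀ x, ∃ O ∈ good, x ∈ O := by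
    intro x
    rcases lt_or_ge (φ x) b with h | h
    · obtain ⟨V, hV, hx, hVs⟩ := hz x {y | φ y < b} ((isOpen_lt hφ continuous_const).mem_nhds h)
      exact ⟨V, ⟨hV, V, hV, Subset.rfl, fun _ h _ => h, hVs⟩, hx⟩
    · obtain ⟨V, hV, hx, hVs⟩ := hz x {y | a < φ y}
        ((isOpen_lt continuous_const hφ).mem_nhds (hab.trans_le h))
      exact ⟨V, ⟨hV, ∅, isClopen_empty, empty_subset _,
        fun y hy h => absurd h (not_le.2 (hVs hy)), by simp⟩, hx⟩
  have hfin : ∀ E : Set X, E.Finite → ∃ O ∈ good, E ⊆ O := by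
    intro E hE
    induction E, hE using Set.Finite.induction_on with
    | empty => exact ⟨∅, ⟨isClopen_empty, ∅, isClopen_empty, Subset.rfl, by simp, by simp⟩, Subset.rfl⟩
    | insert _ _ ih =>
      rename_i x s _ _
      obtain ⟨O, hO, hs⟩ := ih
      obtain ⟨O', hO', hx⟩ := hpt x
      refine ⟨O ∪ O', hun _ hO _ hO', ?_⟩
      rintro y (rfl | hy)
      · exact Or.inr hx
      · exact Or.inl (hs hy)
  by_cases hu : univ ∈ good
  · obtain ⟨_, C, hC, _, h1, h2⟩ := hu
    exact ⟨C, hC, fun x => h1 x trivial, h2⟩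
  · obtain ⟨𝒱, h𝒱, hcount, hω⟩ := ha good (fun U hU => hU.1) ⟨hu, hfin⟩
    obtain ⟨U0, hU0, _⟩ := hω.2 ∅ finite_empty
    obtain ⟨O, hO⟩ := hcount.exists_eq_range ⟨U0, hU0⟩
    have hOg : ∀ n, O n ∈ good := fun n => h𝒱 (hO ▸ mem_range_self n)
    choose hOc C hC hCO h1 h2 using hOg
    have hcov : ∀ x, ∃ n, x ∈ disjointed O n := by
      intro x
      obtain ⟨U, hU, hx⟩ := hω.2 {x} (finite_singleton x)
      rw [hO] at hU
      obtain ⟨n, rfl⟩ := hU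
      have : x ∈ ⋃ n, disjointed O n := by
        rw [iUnion_disjointed]; exact mem_iUnion_of_mem n (hx rfl)
      exact mem_iUnion.1 this
    have hdc : ∀ n, IsClopen (disjointed O n) := by
      intro n
      rw [disjointed_eq_inter_compl]
      refine (hOc n).inter ?_
      exact Set.Finite.isClopen_biInter (Set.finite_lt_nat n) fun i _ => (hOc i).compl
    have hdd := disjoint_disjointed O
    refine ⟨⋃ n, C n ∩ disjointed O n, ⟨⟨?_⟩, isOpen_iUnion fun n => ((hC n).inter (hdc n)).isOpen⟩, ?_, ?_⟩
    · have : (⋃ n, C n ∩ disjointed O n)ᶜ = ⋃ n, disjointed O n \ C n := by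
        ext x
        obtain ⟨n, hn⟩ := hcov x
        have huniq : ∀ m, x ∈ disjointed O m → m = n := by
          intro m hm
          by_contra hne
          exact Set.disjoint_left.1 (hdd hne) hm hn
        simp only [mem_compl_iff, mem_iUnion, mem_inter_iff, Set.mem_sdiff, not_exists, not_and]
        constructor
        · intro h
          exact ⟨n, hn, fun hc => h n hc hn⟩
        · rintro ⟨m, hm, hm'⟩ k hk hk'
          rw [huniq m hm] at hm'
          rw [huniq k hk'] at hk
          exact hm' hk
      rw [this]
      exact isOpen_iUnion fun n => ((hdc n).diff (hC n)).isOpen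
    · intro x hx
      obtain ⟨n, hn⟩ := hcov x
      exact mem_iUnion_of_mem n ⟨h1 n x (disjointed_subset _ _ hn) hx, hn⟩
    · intro x hx
      obtain ⟨n, hn, _⟩ := mem_iUnion.1 hx
      exact h2 n x hn

end S18
namespace S18

lemma thin {α : Type*} (G : ℕ → Set α) (hf : ∀ n, (G n).Finite)
    (hfo : ∀ a, {k | a ∈ G k}.Finite) :
    ∃ s : ℕ → ℕ, StrictMono s ∧ ∀ m n, m ≠ n → Disjoint (G (s m)) (G (s n)) := by
  have hstep : ∀ n, ∃ N, n < N ∧ ∀ k ≥ N, ∀ j ≤ n, Disjoint (G j) (G k) := by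
    intro n
    have hfin : (⋃ j ∈ Set.Iic n, ⋃ a ∈ G j, {k | a ∈ G k}).Finite :=
      (Set.finite_Iic n).biUnion fun j _ => (hf j).biUnion fun a _ => hfo a
    obtain ⟨B, hB⟩ := hfin.bddAbove
    refine ⟨max B n + 1, by omega, fun k hk j hj => ?_⟩
    rw [Set.disjoint_left]
    intro a ha hak
    have : k ≤ B := hB (by
      simp only [mem_iUnion]
      exact ⟨j, hj, a, ha, hak⟩)
    omega
  choose N hN hd using hstep
  let s : ℕ → ℕ := fun n => Nat.rec 0 (fun _ m => N m) n
  have hs : StrictMono s := strictMono_nat_of_lt_succ fun n => hN (s n)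
  have key : ∀ m n, m < n → Disjoint (G (s m)) (G (s n)) := by
    intro m n hmn
    exact hd (s m) (s n) (hs.monotone (Nat.succ_le_of_lt hmn) : s (m+1) ≤ s n) (s m) le_rfl
  refine ⟨s, hs, fun m n hmn => ?_⟩
  rcases lt_or_gt_of_ne hmn with h | h
  · exact key _ _ h
  · exact (key _ _ h).symm

lemma rez_of {X : Type*} [TopologicalSpace X] (A : Set (Cp X)) (f : Cp X)
    (G : ℕ → Set (Cp X)) (hGA : ∀ n, G n ⊆ A) (hf : ∀ n, (G n).Finite)
    (hfo : ∀ a, {k | a ∈ G k}.Finite)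
    (hG : ∀ E : Set X, E.Finite → ∀ ε : ℝ, 0 < ε → ∀ᶠ k in atTop, ∃ g ∈ G k,
      ∀ x ∈ E, |g.1 x - f.1 x| < ε) :
    ∃ F : ℕ → Set (Cp X), (∀ n, F n ⊆ A ∧ (F n).Finite) ∧
      (∀ m n, m ≠ n → Disjoint (F m) (F n)) ∧
      ∀ U ∈ nhds f, ∀ᶠ n in Filter.atTop, (F n ∩ U).Nonempty := by
  obtain ⟨s, hs, hd⟩ := thin G hf hfo
  refine ⟨G ∘ s, fun n => ⟨hGA _, hf _⟩, hd, fun U hU => ?_⟩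
  obtain ⟨E, hE, ε, hε, h⟩ := nhds_Cp f U hU
  filter_upwards [hs.tendsto_atTop.eventually (hG E hE ε hε)] with n ⟨g, hg, hgE⟩
  exact ⟨g, hg, h g hgE⟩

noncomputable def ee (n : ℕ) : ℝ := 1 / ((n : ℝ) + 1)

lemma ee_pos (n : ℕ) : 0 < ee n := Nat.one_div_pos_of_nat
lemma ee_anti {m n : ℕ} (h : m ≤ n) : ee n ≤ ee m := Nat.one_div_le_one_div h
lemma ee_lt (n : ℕ) : ee (n+1) < ee n := Nat.one_div_lt_one_div (Nat.lt_succ_self n)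
lemma ee_small (ε : ℝ) (h : 0 < ε) : ∃ n, ee n < ε := exists_nat_one_div_lt h

lemma two_one {X : Type*} [TopologicalSpace X] (hz : ZeroDimensionalSpace X)
    (h2a : Two_a X) (h2b : Two_b X) : ReznichenkoProp (Cp X) := by
  classical
  intro A f hfA
  have hcl : ∀ E : Set X, E.Finite → ∀ ε : ℝ, 0 < ε → ∃ g ∈ A, ∀ x ∈ E, |g.1 x - f.1 x| < ε := by
    intro E hE ε hε
    obtain ⟨g, hg, hgA⟩ := mem_closure_iff_nhds.1 hfA.1 _ (mem_nhds_Cp f E hE ε hε)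
    exact ⟨g, hgA, hg⟩
  by_cases hunif : ∀ n, ∃ g ∈ A, ∀ x, |g.1 x - f.1 x| < ee n
  · choose g hgA hg using hunif
    refine rez_of A f (fun n => {g n}) (by simpa using hgA) (fun n => finite_singleton _) ?_ ?_
    · intro a
      by_cases haf : a = f
      · convert finite_empty
        ext k
        simp only [mem_singleton_iff, mem_ofPred_eq, mem_empty_iff_false, iff_false]
        rintro rfl
        exact hfA.2 (haf ▸ hgA k)
      · have : ∃ x, a.1 x ≠ f.1 x := by
          by_contra hcon
          push Not at hcon
          exact haf (Subtype.ext (funext hcon))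
        obtain ⟨x, hx⟩ := this
        obtain ⟨n, hn⟩ := ee_small _ (abs_pos.2 (sub_ne_zero.2 hx))
        apply (Set.finite_lt_nat n).subset
        rintro k rfl
        by_contra hk
        have := (hg k x).trans_le (ee_anti (not_lt.1 hk))
        exact absurd hn (not_lt.2 this.le)
    · intro E _ ε hε
      obtain ⟨n, hn⟩ := ee_small ε hε
      filter_upwards [eventually_ge_atTop n] with k hk
      exact ⟨g k, rfl, fun x _ => (hg k x).trans ((ee_anti hk).trans_lt hn)⟩
  push Not at hunif
  obtain ⟨N, hN⟩ := hunif
  have hsep : ∀ (g : Cp X) (n : ℕ), ∃ C : Set X, IsClopen C ∧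
      (∀ x, |g.1 x - f.1 x| ≤ ee (n+1) → x ∈ C) ∧ ∀ x ∈ C, |g.1 x - f.1 x| < ee n :=
    fun g n => sep hz h2a _ (g.2.sub f.2).abs _ _ (ee_lt n)
  choose C hC hC1 hC2 using hsep
  have hCne : ∀ g ∈ A, ∀ n, N ≤ n → ∃ y, y ∉ C g n := by
    intro g hg n hn
    obtain ⟨y, hy⟩ := hN g hg
    exact ⟨y, fun hyC => absurd ((hC2 g n y hyC).trans_le (ee_anti hn)) (not_lt.2 hy)⟩
  -- countable subset
  have hBn : ∀ n, ∃ B ⊆ A, B.Countable ∧ ∀ E : Set X, E.Finite → ∃ g ∈ B, E ⊆ C g (N + n) := by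
    intro n
    obtain ⟨𝒱, h𝒱, hcount, hω⟩ := h2a ((fun g => C g (N+n)) '' A)
      (by rintro _ ⟨g, _, rfl⟩; exact hC _ _)
      ⟨by
        rintro ⟨g, hg, he⟩
        obtain ⟨y, hy⟩ := hCne g hg (N+n) (by omega)
        exact hy (by simp only [he, mem_univ]), by
        intro E hE
        obtain ⟨g, hg, hgE⟩ := hcl E hE _ (ee_pos (N+n+1))
        exact ⟨_, mem_image_of_mem _ hg, fun x hx => hC1 g _ x (hgE x hx).le⟩⟩
    obtain ⟨B, hBA, hb⟩ := Set.SurjOn.exists_bijOn_subset h𝒱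
    refine ⟨B, hBA, ?_, ?_⟩
    · have : ((fun g => C g (N+n)) '' B).Countable := by rw [hb.image_eq]; exact hcount
      exact Set.countable_of_injective_of_countable_image hb.injOn this
    · intro E hE
      obtain ⟨U, hU, hEU⟩ := hω.2 E hE
      rw [← hb.image_eq] at hU
      obtain ⟨g, hg, rfl⟩ := hU
      exact ⟨g, hg, hEU⟩
  choose Bn hBnA hBnc hBnE using hBn
  let B := ⋃ n, Bn n
  have hBA : B ⊆ A := iUnion_subset hBnA
  have hBc : B.Countable := countable_iUnion hBnc
  have hBcl : ∀ E : Set X, E.Finite → ∀ ε : ℝ, 0 < ε → ∃ g ∈ B, ∀ x ∈ E, |g.1 x - f.1 x| < ε := by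
    intro E hE ε hε
    obtain ⟨n, hn⟩ := ee_small ε hε
    obtain ⟨g, hg, hgE⟩ := hBnE n E hE
    refine ⟨g, mem_iUnion_of_mem n hg, fun x hx => ?_⟩
    exact (hC2 g _ x (hgE hx)).trans ((ee_anti (by omega)).trans_lt hn)
  obtain ⟨x0⟩ : Nonempty X := by
    obtain ⟨g, hg, _⟩ := hcl ∅ finite_empty 1 one_pos
    obtain ⟨y, _⟩ := hN g hg
    exact ⟨y⟩
  have : Nonempty X := ⟨x0⟩
  choose! y hy using fun g (hg : g ∈ A) => hCne g hg N le_rfl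
  have hBi : B.Infinite := by
    intro hfin
    obtain ⟨g, hg, hgE⟩ := hBcl (y '' B) (hfin.image _) _ (ee_pos (N+1))
    exact hy g (hBA hg) (hC1 g N _ (hgE _ (mem_image_of_mem _ hg)).le)
  obtain ⟨e⟩ := Set.countable_infinite_iff_nonempty_denumerable.1 ⟨hBc, hBi⟩
  let q : ℕ → Cp X := fun i => ((Denumerable.eqv B).symm i : B)
  have hqB : ∀ i, q i ∈ B := fun i => Subtype.property _
  have hqinj : Function.Injective q := Subtype.val_injective.comp (Equiv.injective _)
  have hqs : ∀ g ∈ B, ∃ i, q i = g := fun g hg => ⟨Denumerable.eqv B ⟨g, hg⟩, by simp [q]⟩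
  have hyq : ∀ i, y (q i) ∉ C (q i) N := fun i => hy _ (hBA (hqB i))
  have P : ∀ E : Set X, E.Finite → ∀ n M, N ≤ n → ∃ i ≥ M, E ⊆ C (q i) n := by
    intro E hE n M hn
    obtain ⟨g, hg, hgE⟩ := hBcl (E ∪ (fun i => y (q i)) '' Set.Iio M)
      (hE.union ((Set.finite_Iio M).image _)) _ (ee_pos (n+1))
    obtain ⟨i, rfl⟩ := hqs g hg
    refine ⟨i, ?_, fun x hx => hC1 _ _ x (hgE x (Or.inl hx)).le⟩
    by_contra hi
    refine hyq i (hC1 _ _ _ ((hgE _ (Or.inr ⟨i, not_le.1 hi, rfl⟩)).le.trans (ee_anti (by omega))))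
  let D : ℕ → Set X := fun p => if p.unpair.1 ≤ p.unpair.2 then
    C (q p.unpair.1) N ∩ C (q p.unpair.2) (N + p.unpair.1) else ∅
  have hD : ∀ p, IsClopen (D p) := by
    intro p
    simp only [D]
    split_ifs
    · exact (hC _ _).inter (hC _ _)
    · exact isClopen_empty
  obtain ⟨h, hh, hh2⟩ := h2b (fun x p => decide (x ∈ D p))
    (by
      refine continuous_pi fun p => ?_
      exact (continuous_bool_rng true).2 (by
        convert hD p using 1
        ext x; simp))
    (by
      intro E hE
      rw [Set.infinite_iff_exists_gt]
      intro M
      obtain ⟨m, hm, hmE⟩ := P E hE N (M+1) le_rfl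
      obtain ⟨i, hi, hiE⟩ := P E hE (N+m) m (by omega)
      refine ⟨Nat.pair m i, ?_, lt_of_lt_of_le (by omega) (Nat.left_le_pair m i)⟩
      intro x hx
      simp only [D, Nat.unpair_pair, decide_eq_true_eq, if_pos hi]
      exact ⟨hmE hx, hiE hx⟩)
  refine rez_of A f (fun k => (fun p => q p.unpair.2) ''
    {p | h k ≤ p ∧ p < h (k+1) ∧ p.unpair.1 ≤ p.unpair.2}) ?_ ?_ ?_ ?_
  · rintro k _ ⟨p, _, rfl⟩
    exact hBA (hqB _)
  · intro k
    exact ((Set.finite_lt_nat (h (k+1))).subset fun p hp => hp.2.1).image _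
  · intro a
    by_cases ha : ∃ i, q i = a
    · obtain ⟨i, rfl⟩ := ha
      apply (Set.finite_lt_nat ((i+1)^2)).subset
      rintro k ⟨p, ⟨hp1, hp2, hp3⟩, hp4⟩
      have h4 : p.unpair.2 = i := hqinj hp4
      have h5 := Nat.pair_lt_max_add_one_sq p.unpair.1 p.unpair.2
      rw [Nat.pair_unpair, max_eq_right hp3, h4] at h5
      exact lt_of_le_of_lt ((hh.id_le k).trans hp1) h5
    · convert finite_empty
      ext k
      simp only [mem_ofPred_eq, mem_empty_iff_false, iff_false]
      rintro ⟨p, _, hp⟩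
      exact ha ⟨_, hp⟩
  · intro E hE ε hε
    obtain ⟨M, hM⟩ := ee_small ε hε
    filter_upwards [hh2 (insert x0 E ∪ (fun i => y (q i)) '' Set.Iio M)
      ((hE.insert x0).union ((Set.finite_Iio M).image _))] with k ⟨p, hp1, hp2, hp3⟩
    have hp3' : ∀ x ∈ insert x0 E ∪ (fun i => y (q i)) '' Set.Iio M, x ∈ D p := fun x hx => by
      simpa using hp3 x hx
    by_cases hle : p.unpair.1 ≤ p.unpair.2
    · have hDp : D p = C (q p.unpair.1) N ∩ C (q p.unpair.2) (N + p.unpair.1) := if_pos hle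
      rw [hDp] at hp3'
      refine ⟨q p.unpair.2, ⟨p, ⟨hp1, hp2, hle⟩, rfl⟩, fun x hx => ?_⟩
      have hm : M ≤ p.unpair.1 := by
        by_contra hlt
        exact hyq _ (hp3' _ (Or.inr ⟨p.unpair.1, not_le.1 hlt, rfl⟩)).1
      exact (hC2 _ _ x (hp3' x (Or.inl (Or.inr hx))).2).trans ((ee_anti (by omega)).trans_lt hM)
    · have hDp : D p = ∅ := if_neg hle
      have := hp3' x0 (Or.inl (Or.inl rfl))
      rw [hDp] at this
      exact this.elim

end S18
namespace S18

def Three (X : Type*) [TopologicalSpace X] : Prop :=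
  ∀ 𝒰 : Set (Set X), (∀ U ∈ 𝒰, IsClopen U) → IsOmegaCover 𝒰 →
        ∃ 𝒱 ⊆ 𝒰, (∀ x : X, ∃ U ∈ 𝒱, x ∈ U) ∧ IsOmegaGroupable 𝒱

lemma compact_fin {X : Type*} [TopologicalSpace X] [CompactSpace X] {ι : Type*}
    (U : ι → Set X) (hU : ∀ i, IsOpen (U i))
    (hω : ∀ E : Set X, E.Finite → ∃ i, E ⊆ U i) (k : ℕ) :
    ∃ t : Finset ι, ∀ x : Fin k → X, ∃ i ∈ t, ∀ j, x j ∈ U i := by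
  obtain ⟨t, ht⟩ := isCompact_univ.elim_finite_subcover
    (fun i => {x : Fin k → X | ∀ j, x j ∈ U i})
    (fun i => by
      have : {x : Fin k → X | ∀ j, x j ∈ U i} = ⋂ j, (fun x : Fin k → X => x j) ⁻¹' U i := by
        ext x; simp
      rw [this]
      exact isOpen_iInter_of_finite fun j => (hU i).preimage (continuous_apply j))
    (fun x _ => by
      obtain ⟨i, hi⟩ := hω (range x) (finite_range x)
      exact mem_iUnion_of_mem i fun j => hi (mem_range_self j))
  refine ⟨t, fun x => ?_⟩
  have := ht (mem_univ x)
  simp only [mem_iUnion] at this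
  obtain ⟨i, hi, hx⟩ := this
  exact ⟨i, hi, hx⟩

lemma fin_enum {X : Type*} (E : Set X) (hE : E.Finite) : ∃ k, ∃ x : Fin k → X, range x = E := by
  obtain ⟨k, x, hx⟩ := hE.fin_param
  exact ⟨k, x, hx.2⟩

lemma compact_a {X : Type*} [TopologicalSpace X] [CompactSpace X] : Two_a X := by
  intro 𝒰 hcl hω
  choose t ht using compact_fin (fun U : 𝒰 => U.1) (fun U => (hcl U.1 U.2).isOpen)
    (fun E hE => by
      obtain ⟨U, hU, h⟩ := hω.2 E hE
      exact ⟨⟨U, hU⟩, h⟩)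
  have hsub : (⋃ k, Subtype.val '' (t k : Set 𝒰)) ⊆ 𝒰 := by
    refine iUnion_subset fun k => ?_
    rintro _ ⟨U, _, rfl⟩
    exact U.2
  refine ⟨_, hsub, countable_iUnion fun k => ((t k).finite_toSet.image _).countable,
    fun h => hω.1 (hsub h), fun E hE => ?_⟩
  obtain ⟨k, x, rfl⟩ := fin_enum E hE
  obtain ⟨U, hU, hx⟩ := ht k x
  refine ⟨U, mem_iUnion_of_mem k ⟨U, hU, rfl⟩, ?_⟩
  rintro _ ⟨j, rfl⟩
  exact hx j

lemma clopen_of_cont {X : Type*} [TopologicalSpace X] {Ψ : X → ℕ → Bool} (hΨ : Continuous Ψ)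
    (n : ℕ) : IsClopen {x | Ψ x n = true} := by
  have : Continuous fun x => Ψ x n := (continuous_apply n).comp hΨ
  exact (isClopen_discrete {true}).preimage this

lemma compact_b {X : Type*} [TopologicalSpace X] [CompactSpace X] : Two_b X := by
  intro Ψ hΨ hc
  have hM : ∀ m n, ∃ M, m < M ∧ ∀ k ≤ n, ∀ x : Fin k → X, ∃ i, m ≤ i ∧ i < M ∧ ∀ j, Ψ (x j) i = true := by
    intro m n
    choose t ht using compact_fin (fun i : {i // m ≤ i} => {x | Ψ x i.1 = true})
      (fun i => (clopen_of_cont hΨ i.1).isOpen)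
      (fun E hE => by
        obtain ⟨i, hi, hmi⟩ := (hc E hE).exists_gt m
        exact ⟨⟨i, hmi.le⟩, hi⟩)
    have hfin : (⋃ k ∈ Set.Iic n, Subtype.val '' (t k : Set {i // m ≤ i})).Finite :=
      (Set.finite_Iic n).biUnion fun k _ => (t k).finite_toSet.image _
    obtain ⟨B, hB⟩ := hfin.bddAbove
    refine ⟨max B m + 1, by omega, fun k hk x => ?_⟩
    obtain ⟨i, hi, hx⟩ := ht k x
    have : i.1 ≤ B := hB (by
      simp only [mem_iUnion]
      exact ⟨k, hk, i, hi, rfl⟩)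
    exact ⟨i.1, i.2, by omega, hx⟩
  choose M hM1 hM2 using hM
  let h : ℕ → ℕ := fun n => Nat.rec 0 (fun n m => M m n) n
  refine ⟨h, strictMono_nat_of_lt_succ fun n => hM1 (h n) n, fun E hE => ?_⟩
  obtain ⟨k, x, rfl⟩ := fin_enum E hE
  filter_upwards [eventually_ge_atTop k] with n hn
  obtain ⟨i, h1, h2, h3⟩ := hM2 (h n) n k hn x
  refine ⟨i, h1, h2, ?_⟩
  rintro _ ⟨j, rfl⟩
  exact h3 j

/-- A proper clopen ideal containing all finite sets. -/
lemma noncompact_ideal {X : Type*} [TopologicalSpace X] (hz : ZeroDimensionalSpace X)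
    (hX : ¬ CompactSpace X) : ∃ 𝒲 : Set (Set X), (∀ W ∈ 𝒲, IsClopen W) ∧ IsOmegaCover 𝒲 ∧
      (∀ W ∈ 𝒲, ∀ V, IsClopen V → V ⊆ W → V ∈ 𝒲) ∧ (∀ W ∈ 𝒲, ∀ V ∈ 𝒲, W ∪ V ∈ 𝒲) := by
  classical
  have : ∃ (ι : Type _) (U : ι → Set X), (∀ i, IsOpen (U i)) ∧ (univ ⊆ ⋃ i, U i) ∧
      ∀ t : Finset ι, ¬ univ ⊆ ⋃ i ∈ t, U i := by
    by_contra hcon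
    push Not at hcon
    exact hX ⟨isCompact_of_finite_subcover fun {ι} U hU hs => hcon ι U hU hs⟩
  obtain ⟨ι, U, hU, hcov, hno⟩ := this
  have hun : ∀ W ∈ {W | IsClopen W ∧ ∃ t : Finset ι, W ⊆ ⋃ i ∈ t, U i},
      ∀ V ∈ {W | IsClopen W ∧ ∃ t : Finset ι, W ⊆ ⋃ i ∈ t, U i},
      W ∪ V ∈ {W | IsClopen W ∧ ∃ t : Finset ι, W ⊆ ⋃ i ∈ t, U i} := by
    rintro W ⟨hW, t, ht⟩ V ⟨hV, s, hs⟩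
    refine ⟨hW.union hV, t ∪ s, ?_⟩
    rw [Finset.set_biUnion_union]
    exact union_subset_union ht hs
  refine ⟨{W | IsClopen W ∧ ∃ t : Finset ι, W ⊆ ⋃ i ∈ t, U i}, fun W hW => hW.1, ⟨?_, ?_⟩, ?_, hun⟩
  · rintro ⟨_, t, ht⟩
    exact hno t ht
  · intro E hE
    induction E, hE using Set.Finite.induction_on with
    | empty => exact ⟨∅, ⟨isClopen_empty, ∅, empty_subset _⟩, Subset.rfl⟩
    | insert _ _ ih =>
      rename_i x s _ _
      obtain ⟨O, hO, hs⟩ := ih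
      obtain ⟨i, hi⟩ := mem_iUnion.1 (hcov (mem_univ x))
      obtain ⟨V, hV, hx, hVU⟩ := hz x (U i) ((hU i).mem_nhds hi)
      refine ⟨O ∪ V, hun _ hO _ ⟨hV, {i}, by simpa using hVU⟩, ?_⟩
      rintro y (rfl | hy)
      · exact Or.inr hx
      · exact Or.inl (hs hy)
  · rintro W ⟨_, t, ht⟩ V hV hVW
    exact ⟨hV, t, hVW.trans ht⟩

lemma group_seq {X : Type*} [TopologicalSpace X] (h3 : Three X) (𝒲 : Set (Set X))
    (hcl : ∀ W ∈ 𝒲, IsClopen W) (hω : IsOmegaCover 𝒲)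
    (hun : ∀ W ∈ 𝒲, ∀ V ∈ 𝒲, W ∪ V ∈ 𝒲)
    (𝒰 : Set (Set X)) (h𝒰 : 𝒰 ⊆ 𝒲) (hω' : IsOmegaCover 𝒰) :
    ∃ G : ℕ → Set (Set X), (∀ n, (G n).Finite ∧ G n ⊆ 𝒰) ∧
      (∀ m n, m ≠ n → Disjoint (G m) (G n)) ∧
      ∀ E : Set X, E.Finite → ∀ᶠ n in atTop, ∃ U ∈ G n, E ⊆ U := by
  obtain ⟨𝒱, h𝒱, hcov, 𝒬, hfin, hdis, hU, hE⟩ := h3 𝒰 (fun U hU => hcl U (h𝒰 hU)) hω'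
  have hinf : 𝒬.Infinite := by
    intro hQ
    have hVf : 𝒱.Finite := by rw [← hU]; exact hQ.sUnion hfin
    have key : ∀ 𝒯 : Set (Set X), 𝒯.Finite → 𝒯 ⊆ 𝒲 → ∃ W ∈ 𝒲, ⋃₀ 𝒯 ⊆ W := by
      intro 𝒯 h𝒯
      induction 𝒯, h𝒯 using Set.Finite.induction_on with
      | empty =>
        intro _
        obtain ⟨W, hW, _⟩ := hω.2 ∅ finite_empty
        exact ⟨W, hW, by simp⟩
      | insert _ _ ih =>
        rename_i V s _ _
        intro hs
        obtain ⟨W, hW, hsW⟩ := ih ((subset_insert _ _).trans hs)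
        refine ⟨V ∪ W, hun _ (hs (mem_insert _ _)) _ hW, ?_⟩
        rw [sUnion_insert]
        exact union_subset_union_right _ hsW
    obtain ⟨W, hW, hs⟩ := key 𝒱 hVf (h𝒱.trans h𝒰)
    have : W = univ := by
      refine eq_univ_of_forall fun x => hs ?_
      obtain ⟨U, hU, hx⟩ := hcov x
      exact ⟨U, hU, hx⟩
    exact hω.1 (this ▸ hW)
  let e := hinf.natEmbedding
  refine ⟨fun n => (e n).1, fun n => ⟨hfin _ (e n).2, ?_⟩, ?_, ?_⟩
  · refine Subset.trans ?_ h𝒱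
    rw [← hU]
    exact subset_sUnion_of_mem (e n).2
  · intro m n hmn
    exact hdis (e m).2 (e n).2 fun h => hmn (e.injective (Subtype.ext h))
  · intro E hEf
    rw [← Nat.cofinite_eq_atTop, Filter.eventually_cofinite]
    have := (hE E hEf).preimage (f := fun n => (e n).1)
      ((Subtype.val_injective.comp e.injective).injOn)
    exact this.subset fun n hn => ⟨(e n).2, hn⟩

lemma noncompact_a {X : Type*} [TopologicalSpace X] (hz : ZeroDimensionalSpace X)
    (hX : ¬ CompactSpace X) (h3 : Three X) : Two_a X := by
  obtain ⟨𝒲, hcl, hω, hdown, hun⟩ := noncompact_ideal hz hX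
  intro 𝒰 h𝒰 hω𝒰
  obtain ⟨G, hG, _, hGE⟩ := group_seq h3 𝒲 hcl hω hun {V | V ∈ 𝒲 ∧ ∃ U ∈ 𝒰, V ⊆ U}
    (fun V hV => hV.1) ⟨fun h => hω.1 h.1, fun E hE => by
      obtain ⟨U, hU, hEU⟩ := hω𝒰.2 E hE
      obtain ⟨W, hW, hEW⟩ := hω.2 E hE
      exact ⟨U ∩ W, ⟨hdown W hW _ ((h𝒰 U hU).inter (hcl W hW)) inter_subset_right,
        U, hU, inter_subset_left⟩, subset_inter hEU hEW⟩⟩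
  choose! u hu hVu using fun (V : Set X) (hV : V ∈ {V | V ∈ 𝒲 ∧ ∃ U ∈ 𝒰, V ⊆ U}) => hV.2
  have hsub : u '' (⋃ n, G n) ⊆ 𝒰 := by
    rintro _ ⟨V, hV, rfl⟩
    obtain ⟨n, hn⟩ := mem_iUnion.1 hV
    exact hu V ((hG n).2 hn)
  refine ⟨u '' (⋃ n, G n), hsub, (countable_iUnion fun n => (hG n).1.countable).image _,
    fun h => hω𝒰.1 (hsub h), fun E hE => ?_⟩
  obtain ⟨n, V, hV, hEV⟩ := (hGE E hE).exists
  exact ⟨u V, mem_image_of_mem _ (mem_iUnion_of_mem n hV), hEV.trans (hVu V ((hG n).2 hV))⟩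

lemma intervals (I : ℕ → Set ℕ) (hf : ∀ n, (I n).Finite)
    (hd : ∀ m n, m ≠ n → Disjoint (I m) (I n)) :
    ∃ h : ℕ → ℕ, StrictMono h ∧ ∀ n, ∃ k ≥ n, ∀ i ∈ I k, h n ≤ i ∧ i < h (n+1) := by
  have hstep : ∀ m n, ∃ M, m < M ∧ ∃ k ≥ n, ∀ i ∈ I k, m ≤ i ∧ i < M := by
    intro m n
    have hfin : (⋃ i ∈ Set.Iio m, {k | i ∈ I k}).Finite := by
      refine (Set.finite_Iio m).biUnion fun i _ => Set.Subsingleton.finite ?_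
      intro a ha b hb
      by_contra hab
      exact Set.disjoint_left.1 (hd a b hab) ha hb
    obtain ⟨B, hB⟩ := hfin.bddAbove
    obtain ⟨C, hC⟩ := (hf (max B n + 1)).bddAbove
    refine ⟨max C m + 1, by omega, max B n + 1, by omega, fun i hi => ⟨?_, ?_⟩⟩
    · by_contra hlt
      have : max B n + 1 ≤ B := hB (by
        simp only [mem_iUnion]
        exact ⟨i, not_le.1 hlt, hi⟩)
      omega
    · have : i ≤ C := hC hi
      omega
  choose M hM1 hM2 using hstep
  let h : ℕ → ℕ := fun n => Nat.rec 0 (fun n m => M m n) n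
  exact ⟨h, strictMono_nat_of_lt_succ fun n => hM1 (h n) n, fun n => hM2 (h n) n⟩

lemma noncompact_b {X : Type*} [TopologicalSpace X] (hz : ZeroDimensionalSpace X)
    (hX : ¬ CompactSpace X) (h3 : Three X) : Two_b X := by
  obtain ⟨𝒲, hcl, hω, hdown, hun⟩ := noncompact_ideal hz hX
  obtain ⟨𝒱, h𝒱, hcount, hω𝒱⟩ := noncompact_a hz hX h3 𝒲 hcl hω
  obtain ⟨U0, hU0, _⟩ := hω𝒱.2 ∅ finite_empty
  obtain ⟨w, hw⟩ := hcount.exists_eq_range ⟨U0, hU0⟩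
  have hw𝒲 : ∀ n, w n ∈ 𝒲 := fun n => h𝒱 (hw ▸ mem_range_self n)
  let W : ℕ → Set X := fun n => partialSups w n
  have hW : ∀ n, W n ∈ 𝒲 := by
    intro n
    induction n with
    | zero => simpa [W] using hw𝒲 0
    | succ n ih =>
      have : W (n+1) = W n ∪ w (n+1) := partialSups_add_one w n
      rw [this]
      exact hun _ ih _ (hw𝒲 _)
  have hWE : ∀ E : Set X, E.Finite → ∃ m, ∀ n ≥ m, E ⊆ W n := by
    intro E hE
    obtain ⟨U, hU, hEU⟩ := hω𝒱.2 E hE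
    rw [hw] at hU
    obtain ⟨m, rfl⟩ := hU
    exact ⟨m, fun n hn => hEU.trans (le_partialSups_of_le w hn)⟩
  intro Ψ hΨ hc
  let V : ℕ → Set X := fun n => {x | Ψ x n = true} ∩ W n
  obtain ⟨G, hG, hGd, hGE⟩ := group_seq h3 𝒲 hcl hω hun (range V)
    (by
      rintro _ ⟨n, rfl⟩
      exact hdown _ (hW n) _ ((clopen_of_cont hΨ n).inter (hcl _ (hW n))) inter_subset_right)
    ⟨by
      rintro ⟨n, hn⟩
      apply hω.1
      have : W n = univ := univ_subset_iff.1 (hn ▸ inter_subset_right)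
      exact this ▸ hW n, by
      intro E hE
      obtain ⟨m, hm⟩ := hWE E hE
      obtain ⟨n, hn, hmn⟩ := (hc E hE).exists_gt m
      exact ⟨V n, mem_range_self n, subset_inter hn (hm n hmn.le)⟩⟩
  choose! idx hidx using fun (S : Set X) (hS : S ∈ range V) => hS
  obtain ⟨h, hh, hk⟩ := intervals (fun n => idx '' G n) (fun n => (hG n).1.image _) (by
    intro m n hmn
    rw [Set.disjoint_left]
    rintro _ ⟨S, hS, rfl⟩ ⟨S', hS', he⟩
    have h1 := hidx S ((hG m).2 hS)
    have h2 := hidx S' ((hG n).2 hS')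
    rw [he, h1] at h2
    subst h2
    exact Set.disjoint_left.1 (hGd m n hmn) hS hS')
  refine ⟨h, hh, fun E hE => ?_⟩
  obtain ⟨N, hN⟩ := eventually_atTop.1 (hGE E hE)
  filter_upwards [eventually_ge_atTop N] with n hn
  obtain ⟨k, hkn, hkI⟩ := hk n
  obtain ⟨S, hS, hES⟩ := hN k (hn.trans hkn)
  obtain ⟨h1, h2⟩ := hkI _ (mem_image_of_mem _ hS)
  refine ⟨_, h1, h2, fun x hx => ?_⟩
  have := hES hx
  rw [← hidx S ((hG k).2 hS)] at this
  exact this.1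

lemma three_two {X : Type*} [TopologicalSpace X] (hz : ZeroDimensionalSpace X)
    (h3 : Three X) : Two_a X ∧ Two_b X := by
  by_cases hX : CompactSpace X
  · exact ⟨compact_a, compact_b⟩
  · exact ⟨noncompact_a hz hX h3, noncompact_b hz hX h3⟩

end S18

/-- characterizations of the Reznichenko property of `C_p(X)`
for zero-dimensional Tychonoff `X`. -/
theorem statement18 (X : Type*) [TopologicalSpace X] [T2Space X]
    [CompletelyRegularSpace X] (hz : ZeroDimensionalSpace X) :
    (ReznichenkoProp (Cp X) ↔
      ((∀ 𝒰 : Set (Set X), (∀ U ∈ 𝒰, IsClopen U) → IsOmegaCover 𝒰 →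
          ∃ 𝒱 ⊆ 𝒰, 𝒱.Countable ∧ IsOmegaCover 𝒱) ∧
        -- no continuous image of `X` in `[ℕ]^ω` is a subbase for a
        -- nonfeeble (proper, nonprincipal) filter on ℕ
        ∀ Ψ : X → ℕ → Bool, Continuous Ψ →
          (∀ x, {n | Ψ x n = true}.Infinite) →
          ∀ F : Filter ℕ,
            F = Filter.generate (Set.range fun x => {n | Ψ x n = true}) →
            F ≠ ⊥ → (∀ a : Set ℕ, F ≠ Filter.principal a) →
            ∃ h : ℕ → ℕ, StrictMono h ∧
              ∀ a ∈ F, ∀ᶠ n in Filter.atTop,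
                (a ∩ Set.Ico (h n) (h (n + 1))).Nonempty)) ∧
    (ReznichenkoProp (Cp X) ↔
      ∀ 𝒰 : Set (Set X), (∀ U ∈ 𝒰, IsClopen U) → IsOmegaCover 𝒰 →
        ∃ 𝒱 ⊆ 𝒰, (∀ x : X, ∃ U ∈ 𝒱, x ∈ U) ∧ IsOmegaGroupable 𝒱) := by

  have h13 := S18.one_three (X := X)
  have h32 : S18.Three X → S18.Two_a X ∧ S18.Two_b X := S18.three_two hz
  have h21 : S18.Two_a X ∧ S18.Two_b X → ReznichenkoProp (Cp X) :=
    fun h => S18.two_one hz h.1 h.2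
  refine ⟨⟨fun h => ?_, fun h => ?_⟩, ⟨h13, fun h => h21 (h32 h)⟩⟩
  · obtain ⟨ha, hb⟩ := h32 (h13 h)
    exact ⟨ha, S18.b0_of_b hb⟩
  · exact h21 ⟨h.1, S18.b_of_b0 h.2⟩
end

section
/- Let X = ℚ × ℝ with the product topology. Then C_p(X,{0,1}) is homeomorphic to C_p(ℚ,{0,1}), and C_p(X,{0,1}) has the Pytkeev property, whereas C_p(X) does not have the Pytkeev property. -/
open Set Topology Filter

/-- The grid size used at stage `k`. -/
noncomputable def gridN (k : ℕ) : ℝ := 4 * ((k : ℝ) + 1) ^ 2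

lemma gridN_pos (k : ℕ) : 0 < gridN k := by unfold gridN; positivity

/-- Test function vanishing near the grid points in `T`, and at least one far from them. -/
noncomputable def testFun (k : ℕ) (T : Finset ℤ) (p : ℚ × ℝ) : ℝ :=
  ∏ j ∈ T, max 0 (|gridN k * p.2 - j| - 1)

lemma testFun_cont (k : ℕ) (T : Finset ℤ) : Continuous (testFun k T) := by
  unfold testFun
  fun_prop

/-- Indices of stage `k`. -/
def stage (k : ℕ) : Set (Finset ℤ) :=
  {T | T ⊆ Finset.Icc (-(4 * (k + 1) ^ 2 * k : ℤ)) (4 * (k + 1) ^ 2 * k) ∧ T.card ≤ k}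

lemma stage_finite (k : ℕ) : (stage k).Finite :=
  (Finset.finite_toSet (Finset.powerset
    (Finset.Icc (-(4 * (k + 1) ^ 2 * k : ℤ)) (4 * (k + 1) ^ 2 * k)))).subset
    (fun T hT => Finset.mem_coe.2 (Finset.mem_powerset.2 hT.1))

/-- Functions of stage `k`. -/
def stageFun (k : ℕ) : Set (Cp (ℚ × ℝ)) :=
  (fun T => (⟨testFun k T, testFun_cont k T⟩ : Cp (ℚ × ℝ))) '' stage k

lemma stageFun_finite (k : ℕ) : (stageFun k).Finite := (stage_finite k).image _

lemma stageFun_measure (k : ℕ) (f : Cp (ℚ × ℝ)) (hf : f ∈ stageFun k) :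
    MeasureTheory.volume {x : ℝ | f.1 (0, x) < 1} ≤ ENNReal.ofReal (1 / ((k : ℝ) + 1)) := by
  obtain ⟨T, hT, rfl⟩ := hf
  have hN := gridN_pos k
  have hsub : {x : ℝ | testFun k T (0, x) < 1} ⊆
      ⋃ j ∈ T, Ioo (((j : ℝ) - 2) / gridN k) (((j : ℝ) + 2) / gridN k) := by
    intro x hx
    by_contra hcon
    simp only [mem_iUnion, not_exists] at hcon
    apply absurd hx
    simp only [mem_setOf_eq, not_lt]
    unfold testFun
    refine Finset.prod_induction (fun j : ℤ => max 0 (|gridN k * x - j| - 1))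
      (fun r : ℝ => 1 ≤ r) (fun a b ha hb => one_le_mul_of_one_le_of_one_le ha hb) le_rfl ?_
    intro j hj
    refine le_max_of_le_right ?_
    by_contra hlt
    push Not at hlt
    apply hcon j hj
    have h2 : |gridN k * x - j| < 2 := by linarith
    obtain ⟨h3, h4⟩ := abs_lt.1 h2
    constructor
    · rw [div_lt_iff₀ hN]; linarith
    · rw [lt_div_iff₀ hN]; linarith
  refine (MeasureTheory.measure_mono hsub).trans ?_
  refine (MeasureTheory.measure_biUnion_finset_le _ _).trans ?_
  simp only [Real.volume_Ioo]
  have : ∀ j ∈ T, ENNReal.ofReal (((j : ℝ) + 2) / gridN k - ((j : ℝ) - 2) / gridN k)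
      = ENNReal.ofReal (4 / gridN k) := by
    intro j _
    congr 1
    ring
  rw [Finset.sum_congr rfl this, Finset.sum_const, nsmul_eq_mul, ← ENNReal.ofReal_natCast,
    ← ENNReal.ofReal_mul (by positivity)]
  apply ENNReal.ofReal_le_ofReal
  have h1 : (T.card : ℝ) ≤ k := by exact_mod_cast hT.2
  unfold gridN
  rw [mul_div_assoc', div_le_div_iff₀ (by positivity) (by positivity)]
  have h0 : (0:ℝ) ≤ k := by positivity
  nlinarith [mul_nonneg (sub_nonneg.2 h1) (by linarith : (0:ℝ) ≤ (k:ℝ) + 1)]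

lemma not_pytkeev : ¬ PytkeevProp (Cp (ℚ × ℝ)) := by
  intro h
  let z : Cp (ℚ × ℝ) := ⟨fun _ => 0, continuous_const⟩
  have hzA : z ∈ closure (⋃ k, stageFun k) \ ⋃ k, stageFun k := by
    constructor
    · have key : ∀ F : Finset (ℚ × ℝ), ∃ f ∈ ⋃ k, stageFun k, ∀ p ∈ F, f.1 p = 0 := by
        intro F
        obtain ⟨M, hM⟩ := (F.image (fun p => |p.2|)).bddAbove
        obtain ⟨m, hm⟩ := exists_nat_ge M
        let k := max m F.card
        have hN := gridN_pos k
        refine ⟨_, mem_iUnion.2 ⟨k, F.image (fun p => ⌊gridN k * p.2⌋), ⟨?_, ?_⟩, rfl⟩, ?_⟩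
        · intro j hj
          obtain ⟨p, hp, rfl⟩ := Finset.mem_image.1 hj
          have hpk : |p.2| ≤ (k : ℝ) := by
            have a1 : |p.2| ≤ M := hM (by simpa using ⟨p.1, p.2, hp, rfl⟩)
            have a2 : (m : ℝ) ≤ k := by exact_mod_cast le_max_left _ _
            linarith
          obtain ⟨b1, b2⟩ := abs_le.1 hpk
          rw [Finset.mem_Icc]
          constructor
          · rw [Int.le_floor]
            push_cast
            change -(gridN k * k) ≤ _
            nlinarith
          · have : ((⌊gridN k * p.2⌋ : ℤ) : ℝ) ≤ ((4 * (k + 1) ^ 2 * k : ℤ) : ℝ) := by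
              refine (Int.floor_le _).trans ?_
              push_cast
              change _ ≤ gridN k * k
              nlinarith
            exact_mod_cast this
        · exact Finset.card_image_le.trans (le_max_right _ _)
        · intro p hp
          apply Finset.prod_eq_zero (Finset.mem_image_of_mem _ hp)
          apply max_eq_left
          have c1 := Int.floor_le (gridN k * p.2)
          have c2 := Int.lt_floor_add_one (gridN k * p.2)
          rw [abs_of_nonneg (by linarith)]
          linarith
      rw [mem_closure_iff_nhds]
      intro U hU
      rw [nhds_subtype_eq_comap, Filter.mem_comap] at hU
      obtain ⟨V, hV, hVU⟩ := hU
      rw [nhds_pi, Filter.mem_pi'] at hV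
      obtain ⟨I, t, ht, htV⟩ := hV
      obtain ⟨f, hf, hfz⟩ := key I
      refine ⟨f, hVU (htV ?_), hf⟩
      intro p hp
      rw [hfz p hp]
      exact mem_of_mem_nhds (ht p)
    · intro hz
      obtain ⟨k, hk⟩ := mem_iUnion.1 hz
      have := stageFun_measure k z hk
      simp [z] at this
  obtain ⟨𝒜, h1, h2⟩ := h (⋃ k, stageFun k) z hzA
  · have hnull : ∀ n, MeasureTheory.volume {x : ℝ | ∀ f ∈ 𝒜 n, f.1 (0, x) < 1} = 0 := by
      intro n
      have hle : ∀ k : ℕ, MeasureTheory.volume {x : ℝ | ∀ f ∈ 𝒜 n, f.1 (0, x) < 1}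
          ≤ ENNReal.ofReal (1 / ((k : ℝ) + 1)) := by
        intro k
        have hfin : (⋃ i ∈ Finset.range k, stageFun i).Finite :=
          Set.Finite.biUnion (Finset.finite_toSet _) (fun i _ => stageFun_finite i)
        obtain ⟨f, hf, hfk⟩ := (h1 n).1.exists_notMem_finite hfin
        obtain ⟨m, hm⟩ := mem_iUnion.1 ((h1 n).2 hf)
        have hkm : k ≤ m := by
          by_contra hlt
          apply hfk
          simp only [mem_iUnion]
          exact ⟨m, Finset.mem_range.2 (by omega), hm⟩
        have hsub : {x : ℝ | ∀ g ∈ 𝒜 n, g.1 (0, x) < 1} ⊆ {x : ℝ | f.1 (0, x) < 1} :=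
          fun x hx => hx f hf
        refine (MeasureTheory.measure_mono hsub).trans
          ((stageFun_measure m f hm).trans (ENNReal.ofReal_le_ofReal ?_))
        have : (k : ℝ) ≤ m := by exact_mod_cast hkm
        apply one_div_le_one_div_of_le <;> [positivity; linarith]
      have ht : Tendsto (fun k : ℕ => ENNReal.ofReal (1 / ((k : ℝ) + 1))) atTop (𝓝 0) := by
        have := ENNReal.tendsto_ofReal (tendsto_one_div_add_atTop_nhds_zero_nat (𝕜 := ℝ))
        simpa using this
      exact le_antisymm (ge_of_tendsto' ht hle) bot_le
    have hU := MeasureTheory.measure_iUnion_null hnull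
    obtain ⟨x, hx⟩ : ∃ x : ℝ, x ∉ ⋃ n, {x : ℝ | ∀ f ∈ 𝒜 n, f.1 (0, x) < 1} := by
      by_contra hcon
      push Not at hcon
      rw [Set.eq_univ_of_forall hcon] at hU
      simp at hU
    have hop : IsOpen {f : Cp (ℚ × ℝ) | f.1 (0, x) < 1} :=
      isOpen_Iio.preimage ((continuous_apply ((0 : ℚ), x)).comp continuous_subtype_val)
    obtain ⟨n, hn⟩ := h2 _ (hop.mem_nhds (show z.1 (0, x) < 1 by simp [z]))
    exact hx (mem_iUnion.2 ⟨n, fun f hf => hn hf⟩)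

/-- A first countable T1 space has the Pytkeev property. -/
lemma pytkeev_of_firstCountable (Y : Type*) [TopologicalSpace Y] [T1Space Y]
    [FirstCountableTopology Y] : PytkeevProp Y := by
  rintro A y ⟨hy, hyA⟩
  obtain ⟨u, hu⟩ := (𝓝 y).exists_antitone_basis
  refine ⟨fun n => u n ∩ A, fun n => ⟨?_, inter_subset_right⟩, fun U hU => ?_⟩
  · intro hfin
    have h1 : (u n ∩ A)ᶜ ∈ 𝓝 y :=
      hfin.isClosed.isOpen_compl.mem_nhds (fun h => hyA h.2)
    obtain ⟨w, ⟨hw1, hw2⟩, hw3⟩ :=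
      mem_closure_iff_nhds.1 hy _ (inter_mem h1 (hu.1.mem_of_mem (i := n) trivial))
    exact hw1 ⟨hw2, hw3⟩
  · obtain ⟨n, -, hn⟩ := hu.1.mem_iff.1 hU
    exact ⟨n, inter_subset_left.trans hn⟩

lemma const_fibre (f : CpS (ℚ × ℝ) ({0, 1} : Set ℝ)) (q : ℚ) (x y : ℝ) :
    f.1 (q, x) = f.1 (q, y) := by
  have hc : Continuous (fun t : ℝ => f.1 (q, t)) := f.2.1.comp (by fun_prop)
  have hd : IsPreconnected (range (fun t : ℝ => f.1 (q, t))) := isPreconnected_range hc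
  have hfin : (range (fun t : ℝ => f.1 (q, t))).Finite :=
    (Set.toFinite ({0, 1} : Set ℝ)).subset (by rintro _ ⟨t, rfl⟩; exact f.2.2 _)
  exact hfin.countable.isTotallyDisconnected _ subset_rfl hd ⟨x, rfl⟩ ⟨y, rfl⟩

/-- The homeomorphism between the two function spaces. -/
def cpHomeo : CpS (ℚ × ℝ) ({0, 1} : Set ℝ) ≃ₜ CpS ℚ ({0, 1} : Set ℝ) where
  toFun f := ⟨fun q => f.1 (q, 0), f.2.1.comp (by fun_prop), fun q => f.2.2 _⟩
  invFun g := ⟨fun p => g.1 p.1, g.2.1.comp continuous_fst, fun p => g.2.2 _⟩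
  left_inv f := by
    ext ⟨q, x⟩
    exact const_fibre f q 0 x
  right_inv g := rfl
  continuous_toFun := by
    refine Continuous.subtype_mk (continuous_pi fun q => ?_) _
    exact (continuous_apply (q, (0 : ℝ))).comp continuous_subtype_val
  continuous_invFun := by
    refine Continuous.subtype_mk (continuous_pi fun p => ?_) _
    exact (continuous_apply p.1).comp continuous_subtype_val

/-- for `X = ℚ × ℝ`, `C_p(X,{0,1})` is homeomorphic to
`C_p(ℚ,{0,1})` and has the Pytkeev property, while `C_p(X)` does not. -/
theorem statement19 :
    Nonempty (CpS (ℚ × ℝ) ({0, 1} : Set ℝ) ≃ₜ CpS ℚ ({0, 1} : Set ℝ)) ∧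
    PytkeevProp (CpS (ℚ × ℝ) ({0, 1} : Set ℝ)) ∧
    ¬ PytkeevProp (Cp (ℚ × ℝ)) := by
  refine ⟨⟨cpHomeo⟩, ?_, not_pytkeev⟩
  have : FirstCountableTopology (CpS ℚ ({0, 1} : Set ℝ)) :=
    Topology.IsInducing.subtypeVal.firstCountableTopology
  have : FirstCountableTopology (CpS (ℚ × ℝ) ({0, 1} : Set ℝ)) :=
    cpHomeo.isInducing.firstCountableTopology
  exact pytkeev_of_firstCountable _
end
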